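/- arXiv:1411.3269 — 12 statements merged into one kernel-verified Lean document; each statement's English description precedes it below -/
import Mathlib

section
/- Let (A, B, C) ∈ ℝ³ with A² + BC > 0. Then there exists a finite composition g of the maps T_K (K ∈ ℝ), D_λ (λ ≠ 0), I, and R such that g(A, B, C) = (−√(A² + BC), 0, 0). -/
/-- Translation `T_K (A,B,C) = (A + KB, B, C − 2KA − K²B)`. -/
def transMap (K : ℝ) (p : ℝ × ℝ × ℝ) : ℝ × ℝ × ℝ :=
  (p.1 + K * p.2.1, p.2.1, p.2.2 - 2 * K * p.1 - K ^ 2 * p.2.1)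

/-- Dilation `D_λ (A,B,C) = (A, λ⁻²B, λ²C)`. -/
noncomputable def dilMap (l : ℝ) (p : ℝ × ℝ × ℝ) : ℝ × ℝ × ℝ :=
  (p.1, (l ^ 2)⁻¹ * p.2.1, l ^ 2 * p.2.2)

/-- Inversion `I (A,B,C) = (−A, −C, −B)`. -/
def invMap (p : ℝ × ℝ × ℝ) : ℝ × ℝ × ℝ := (-p.1, -p.2.2, -p.2.1)

/-- Reflection `R (A,B,C) = (A, −B, −C)`. -/
def reflMap (p : ℝ × ℝ × ℝ) : ℝ × ℝ × ℝ := (p.1, -p.2.1, -p.2.2)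

/-- One application of an elementary transformation. -/
def elemStep (p q : ℝ × ℝ × ℝ) : Prop :=
  (∃ K : ℝ, q = transMap K p) ∨ (∃ l : ℝ, l ≠ 0 ∧ q = dilMap l p) ∨
    q = invMap p ∨ q = reflMap p

/-- if `A² + BC > 0`, a finite composition of elementary transformations
brings `(A,B,C)` to `(−√(A² + BC), 0, 0)`. -/
theorem normal_form_Dpos (A B C : ℝ) (h : 0 < A ^ 2 + B * C) :
    Relation.ReflTransGen elemStep (A, B, C) (-Real.sqrt (A ^ 2 + B * C), 0, 0) := by
  have hs : 0 < Real.sqrt (A ^ 2 + B * C) := Real.sqrt_pos.mpr h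
  have hs2 : Real.sqrt (A ^ 2 + B * C) ^ 2 = A ^ 2 + B * C := Real.sq_sqrt h.le
  generalize Real.sqrt (A ^ 2 + B * C) = s at hs hs2
  by_cases hB : B = 0
  · subst hB
    have hA : A ≠ 0 := by
      rintro rfl
      simp at h
    have h1 : elemStep (A, 0, C) (A, 0, 0) := by
      refine Or.inl ⟨C / (2 * A), ?_⟩
      simp only [transMap, Prod.mk.injEq]
      refine ⟨by ring, trivial, ?_⟩
      field_simp
      ring
    have hc : (A - s) * (A + s) = 0 := by linear_combination -hs2
    rcases mul_eq_zero.mp hc with h2 | h2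
    · have h3 : A = s := by linarith
      subst h3
      refine (Relation.ReflTransGen.single h1).tail ?_
      refine Or.inr (Or.inr (Or.inl ?_))
      simp [invMap]
    · have h3 : -s = A := by linarith
      rw [h3]
      exact Relation.ReflTransGen.single h1
  · have h1 : elemStep (A, B, C) (s, B, 0) := by
      refine Or.inl ⟨(s - A) / B, ?_⟩
      simp only [transMap, Prod.mk.injEq]
      refine ⟨by field_simp; ring, trivial, ?_⟩
      field_simp
      linear_combination hs2
    have h2 : elemStep (s, B, 0) (-s, 0, -B) := by
      refine Or.inr (Or.inr (Or.inl ?_))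
      simp [invMap]
    have h3 : elemStep (-s, 0, -B) (-s, 0, 0) := by
      refine Or.inl ⟨B / (2 * s), ?_⟩
      simp only [transMap, Prod.mk.injEq]
      refine ⟨by ring, trivial, ?_⟩
      field_simp
      ring
    exact ((Relation.ReflTransGen.single h1).tail h2).tail h3
end

section
/- Let (A, B, C) ∈ ℝ³ with A² + BC = 0. If (A, B, C) = (0, 0, 0), every composition of elementary transformations fixes it at (0,0,0); if (A, B, C) ≠ (0, 0, 0), there exists a finite composition g of the maps T_K (K ∈ ℝ), D_λ (λ ≠ 0), I, and R such that g(A, B, C) = (0, 0, 1). -/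
theorem reach_of_pos (c : ℝ) (hc : 0 < c) :
    Relation.ReflTransGen elemStep ((0 : ℝ), (0 : ℝ), c) ((0 : ℝ), (0 : ℝ), (1 : ℝ)) := by
  refine .single (Or.inr (Or.inl ⟨√(c⁻¹), (Real.sqrt_pos.mpr (inv_pos.mpr hc)).ne', ?_⟩))
  simp only [dilMap, mul_zero, Real.sq_sqrt (inv_pos.mpr hc).le, inv_mul_cancel₀ hc.ne']

theorem reach_of_ne (c : ℝ) (hc : c ≠ 0) :
    Relation.ReflTransGen elemStep ((0 : ℝ), (0 : ℝ), c) ((0 : ℝ), (0 : ℝ), (1 : ℝ)) := by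
  rcases lt_or_gt_of_ne hc with h | h
  · refine .head (b := (0, 0, -c)) (Or.inr (Or.inr (Or.inr ?_))) (reach_of_pos (-c) (by linarith))
    simp [reflMap]
  · exact reach_of_pos c h

/-- if `A² + BC = 0` then either `(A,B,C) = (0,0,0)`, which is fixed by every
finite composition of elementary transformations, or `(A,B,C) ≠ (0,0,0)` and some finite
composition of elementary transformations brings it to `(0, 0, 1)`. -/
theorem normal_form_Dzero (A B C : ℝ) (h : A ^ 2 + B * C = 0) :
    ((A, B, C) = ((0 : ℝ), (0 : ℝ), (0 : ℝ)) →
      ∀ q : ℝ × ℝ × ℝ, Relation.ReflTransGen elemStep ((0 : ℝ), (0 : ℝ), (0 : ℝ)) q →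
        q = ((0 : ℝ), (0 : ℝ), (0 : ℝ))) ∧
    ((A, B, C) ≠ ((0 : ℝ), (0 : ℝ), (0 : ℝ)) →
      Relation.ReflTransGen elemStep (A, B, C) ((0 : ℝ), (0 : ℝ), (1 : ℝ))) := by
  constructor
  · intro _ q hq
    induction hq with
    | refl => rfl
    | tail _ hs ih =>
      subst ih
      rcases hs with ⟨K, rfl⟩ | ⟨l, _, rfl⟩ | rfl | rfl <;>
        simp [transMap, dilMap, invMap, reflMap]
  · intro hne
    by_cases hB : B = 0
    · subst hB
      have hA : A = 0 := by simpa using h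
      subst hA
      exact reach_of_ne C (fun hC => hne (by rw [hC]))
    · have h1 : elemStep (A, B, C) (0, B, 0) := by
        refine Or.inl ⟨-A / B, ?_⟩
        simp only [transMap, Prod.mk.injEq, true_and]
        constructor
        · field_simp
          ring
        · field_simp
          linarith
      have h2 : elemStep (0, B, 0) (0, 0, -B) := by
        refine Or.inr (Or.inr (Or.inl ?_))
        simp [invMap]
      exact .head h1 (.head h2 (reach_of_ne (-B) (neg_ne_zero.mpr hB)))
end

section
/- Let (A, B, C) ∈ ℝ³ with A² + BC < 0. Then there exists a finite composition g of the maps T_K (K ∈ ℝ), D_λ (λ ≠ 0), I, and R such that g(A, B, C) = (0, −1, |A² + BC|). -/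
theorem normal_form_aux (A B C : ℝ) (h : A ^ 2 + B * C < 0) (hB : B < 0) :
    Relation.ReflTransGen elemStep (A, B, C) ((0 : ℝ), (-1 : ℝ), |A ^ 2 + B * C|) := by
  have hB0 : B ≠ 0 := hB.ne
  have hs : Real.sqrt (-B) ^ 2 = -B := Real.sq_sqrt (by linarith)
  refine (Relation.ReflTransGen.single (b := (0, B, C + A ^ 2 / B)) ?_).tail ?_
  · left
    refine ⟨-A / B, ?_⟩
    simp only [transMap, Prod.mk.injEq]
    refine ⟨?_, trivial, ?_⟩
    · field_simp
      ring
    · field_simp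
      ring
  · right; left
    refine ⟨Real.sqrt (-B), (Real.sqrt_pos.2 (by linarith)).ne', ?_⟩
    simp only [dilMap, hs, Prod.mk.injEq, abs_of_neg h]
    refine ⟨trivial, ?_, ?_⟩
    · rw [inv_neg, neg_mul, inv_mul_cancel₀ hB0]
    · field_simp
      ring

/-- if `A² + BC < 0`, a finite composition of elementary transformations
brings `(A,B,C)` to `(0, −1, |A² + BC|)`. -/
theorem normal_form_Dneg (A B C : ℝ) (h : A ^ 2 + B * C < 0) :
    Relation.ReflTransGen elemStep (A, B, C) ((0 : ℝ), (-1 : ℝ), |A ^ 2 + B * C|) := by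
  have hB0 : B ≠ 0 := by
    rintro rfl
    nlinarith [sq_nonneg A]
  rcases lt_or_gt_of_ne hB0 with hB | hB
  · exact normal_form_aux A B C h hB
  · have h2 := normal_form_aux A (-B) (-C) (by rw [neg_mul_neg]; exact h) (by linarith)
    rw [neg_mul_neg] at h2
    exact Relation.ReflTransGen.head (Or.inr (Or.inr (Or.inr rfl))) h2
end

section
/- Let C₀ ≥ 0, T ∈ (0, ∞], and let a, m : [0, T) → ℝ be differentiable with a(τ) > 0 for all τ, satisfying d(a⁻¹)/dτ = −a⁻¹m and d(a⁻¹m)/dτ = −C₀ a m − a⁻¹ m on [0, T). Then the function τ ↦ a(τ)⁻¹(m(τ) − 1) + C₀ a(τ) is constant on [0, T); moreover, setting a₀ := a(0), m₀ := m(0) and X₀ := a₀⁻¹(m₀ − 1), one has a′(τ) = −a(τ)(C₀ a(τ)² − (C₀a₀ + X₀) a(τ) − 1) for all τ ∈ [0, T). -/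
/-- The half-open interval `[0, T)` of real numbers, for `T ∈ (0, ∞]` an extended real. -/
def erealIco (T : EReal) : Set ℝ := {τ : ℝ | 0 ≤ τ ∧ (τ : EReal) < T}

/-- for the autonomous system `(a⁻¹)′ = −a⁻¹m`, `(a⁻¹m)′ = −C₀am − a⁻¹m`
on `[0, T)`, the quantity `a⁻¹(m − 1) + C₀a` is conserved and
`a′ = −a(C₀a² − (C₀a₀ + X₀)a − 1)` with `a₀ = a(0)`, `X₀ = a₀⁻¹(m₀ − 1)`. -/
theorem homogeneous_system_conserved_quantity
    (C₀ : ℝ) (hC₀ : 0 ≤ C₀) (T : EReal) (hT : 0 < T)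
    (a m : ℝ → ℝ)
    (hapos : ∀ τ ∈ erealIco T, 0 < a τ)
    (hda : ∀ τ ∈ erealIco T,
      HasDerivWithinAt (fun σ => (a σ)⁻¹) (-(a τ)⁻¹ * m τ) (erealIco T) τ)
    (hdam : ∀ τ ∈ erealIco T,
      HasDerivWithinAt (fun σ => (a σ)⁻¹ * m σ)
        (-C₀ * a τ * m τ - (a τ)⁻¹ * m τ) (erealIco T) τ) :
    (∀ τ ∈ erealIco T,
      (a τ)⁻¹ * (m τ - 1) + C₀ * a τ = (a 0)⁻¹ * (m 0 - 1) + C₀ * a 0) ∧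
    (∀ τ ∈ erealIco T,
      HasDerivWithinAt a
        (-(a τ) * (C₀ * (a τ) ^ 2 - (C₀ * a 0 + (a 0)⁻¹ * (m 0 - 1)) * a τ - 1))
        (erealIco T) τ) := by
  have ha : ∀ τ ∈ erealIco T, HasDerivWithinAt a (a τ * m τ) (erealIco T) τ := by
    intro τ hτ
    have h0 := (hapos τ hτ).ne'
    have h := (hda τ hτ).fun_inv (inv_ne_zero h0)
    simp only [inv_inv] at h
    refine h.congr_deriv ?_
    field_simp
  have hconv : Convex ℝ (erealIco T) := by
    apply Set.OrdConnected.convex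
    refine ⟨fun x hx y hy z hz => ⟨hx.1.trans hz.1, lt_of_le_of_lt ?_ hy.2⟩⟩
    exact_mod_cast hz.2
  have h0mem : (0 : ℝ) ∈ erealIco T := ⟨le_refl _, by exact_mod_cast hT⟩
  have hcons : ∀ τ ∈ erealIco T,
      (a τ)⁻¹ * (m τ - 1) + C₀ * a τ = (a 0)⁻¹ * (m 0 - 1) + C₀ * a 0 := by
    intro τ hτ
    have hd : ∀ x ∈ erealIco T, HasDerivWithinAt
        (fun σ => (a σ)⁻¹ * m σ - (a σ)⁻¹ + C₀ * a σ) 0 (erealIco T) x := by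
      intro x hx
      refine (((hdam x hx).fun_sub (hda x hx)).fun_add ((ha x hx).const_mul C₀)).congr_deriv ?_
      ring
    have h := hconv.norm_image_sub_le_of_norm_hasDerivWithin_le (C := 0) hd
      (fun x _ => by simp) h0mem hτ
    rw [zero_mul, norm_le_zero_iff] at h
    linear_combination h
  refine ⟨hcons, fun τ hτ => (ha τ hτ).congr_deriv ?_⟩
  have h := hcons τ hτ
  have h1 : a τ * (a τ)⁻¹ = 1 := mul_inv_cancel₀ (hapos τ hτ).ne'
  linear_combination (a τ)^2 * h - (a τ) * (m τ - 1) * h1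
end

section
/- Let C₀ > 0, a₀ > 0, m₀ > 0, and let a, m : [0, ∞) → ℝ be differentiable with a > 0, a(0) = a₀, m(0) = m₀, satisfying d(a⁻¹)/dτ = −a⁻¹m and d(a⁻¹m)/dτ = −C₀ a m − a⁻¹ m on [0, ∞). Set X₀ := a₀⁻¹(m₀ − 1) and a₊ := ((C₀a₀ + X₀) + √((C₀a₀ + X₀)² + 4C₀))/(2C₀). Then m(τ) > 0 for all τ, a is nondecreasing with a(τ) ∈ (0, a₊) for all τ, a(τ) → a₊ as τ → ∞, and m(τ) → 0 as τ → ∞. -/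
open Filter

theorem aux_anti (f f' : ℝ → ℝ)
    (h : ∀ x ∈ Set.Ici (0:ℝ), HasDerivWithinAt f (f' x) (Set.Ici 0) x)
    (h0 : ∀ x ∈ Set.Ici (0:ℝ), f' x ≤ 0) : AntitoneOn f (Set.Ici 0) := by
  apply antitoneOn_of_hasDerivWithinAt_nonpos (f' := f') (convex_Ici 0)
  · exact fun x hx => (h x hx).continuousWithinAt
  · exact fun x hx => (h x (interior_subset hx)).mono interior_subset
  · exact fun x hx => h0 x (interior_subset hx)

theorem aux_const (f f' : ℝ → ℝ)
    (h : ∀ x ∈ Set.Ici (0:ℝ), HasDerivWithinAt f (f' x) (Set.Ici 0) x)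
    (h0 : ∀ x ∈ Set.Ici (0:ℝ), f' x = 0) : ∀ x ∈ Set.Ici (0:ℝ), f x = f 0 := by
  intro x hx
  have h1 := aux_anti f f' h (fun x hx => (h0 x hx).le) Set.self_mem_Ici hx hx
  have h2 := aux_anti (fun x => - f x) (fun x => - f' x) (fun x hx => (h x hx).neg)
    (fun x hx => by simp [h0 x hx]) Set.self_mem_Ici hx hx
  simp only at h2
  linarith

/-- a linear equation `u' = -g u` preserves positivity -/
theorem aux_pos (u g : ℝ → ℝ) (hg : ContinuousOn g (Set.Ici 0))
    (h : ∀ x ∈ Set.Ici (0:ℝ), HasDerivWithinAt u (-(g x) * u x) (Set.Ici 0) x)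
    (h0 : 0 < u 0) : ∀ x ∈ Set.Ici (0:ℝ), 0 < u x := by
  have hc : Continuous (fun t => g (max t 0)) :=
    hg.comp_continuous (by fun_prop) (fun x => Set.mem_Ici.2 (le_max_right _ _))
  have hG : ∀ x, HasDerivAt (fun t => ∫ s in (0:ℝ)..t, g (max s 0)) (g (max x 0)) x :=
    fun x => intervalIntegral.integral_hasDerivAt_right (hc.intervalIntegrable _ _)
      (hc.stronglyMeasurableAtFilter _ _) hc.continuousAt
  intro x hx
  have := aux_const (fun t => u t * Real.exp (∫ s in (0:ℝ)..t, g (max s 0))) _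
    (fun x hx => (h x hx).mul ((hG x).exp.hasDerivWithinAt)) (fun x hx => by
      rw [max_eq_left (show (0:ℝ) ≤ x from hx)]; ring) x hx
  simp only [intervalIntegral.integral_same, Real.exp_zero, mul_one] at this
  rw [← this] at h0
  exact pos_of_mul_pos_left h0 (Real.exp_pos _).le

/-- case `C₀ > 0` of the spatially homogeneous system: `m` stays positive,
`a` is nondecreasing with values in `(0, a₊)`, `a → a₊` and `m → 0` as `τ → ∞`,
where `a₊ = ((C₀a₀ + X₀) + √((C₀a₀ + X₀)² + 4C₀))/(2C₀)` and `X₀ = a₀⁻¹(m₀ − 1)`. -/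
theorem homogeneous_system_Cpos_asymptotics
    (C₀ a₀ m₀ : ℝ) (hC₀ : 0 < C₀) (ha₀ : 0 < a₀) (hm₀ : 0 < m₀)
    (a m : ℝ → ℝ)
    (hapos : ∀ τ ∈ Set.Ici (0 : ℝ), 0 < a τ)
    (ha0 : a 0 = a₀) (hm0 : m 0 = m₀)
    (hda : ∀ τ ∈ Set.Ici (0 : ℝ),
      HasDerivWithinAt (fun σ => (a σ)⁻¹) (-(a τ)⁻¹ * m τ) (Set.Ici (0 : ℝ)) τ)
    (hdam : ∀ τ ∈ Set.Ici (0 : ℝ),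
      HasDerivWithinAt (fun σ => (a σ)⁻¹ * m σ)
        (-C₀ * a τ * m τ - (a τ)⁻¹ * m τ) (Set.Ici (0 : ℝ)) τ) :
    (∀ τ ∈ Set.Ici (0 : ℝ), 0 < m τ) ∧
    MonotoneOn a (Set.Ici (0 : ℝ)) ∧
    (∀ τ ∈ Set.Ici (0 : ℝ), a τ ∈ Set.Ioo 0
      (((C₀ * a₀ + a₀⁻¹ * (m₀ - 1)) +
        Real.sqrt ((C₀ * a₀ + a₀⁻¹ * (m₀ - 1)) ^ 2 + 4 * C₀)) / (2 * C₀))) ∧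
    Tendsto a atTop (nhds
      (((C₀ * a₀ + a₀⁻¹ * (m₀ - 1)) +
        Real.sqrt ((C₀ * a₀ + a₀⁻¹ * (m₀ - 1)) ^ 2 + 4 * C₀)) / (2 * C₀))) ∧
    Tendsto m atTop (nhds 0) := by
  set K := C₀ * a₀ + a₀⁻¹ * (m₀ - 1) with hK
  set A := (K + Real.sqrt (K ^ 2 + 4 * C₀)) / (2 * C₀) with hA
  have hsq : Real.sqrt (K ^ 2 + 4 * C₀) ^ 2 = K ^ 2 + 4 * C₀ :=
    Real.sq_sqrt (by positivity)
  have hA2 : C₀ * A ^ 2 = K * A + 1 := by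
    rw [hA]; generalize Real.sqrt (K ^ 2 + 4 * C₀) = S at hsq; field_simp; linear_combination hsq
  have hApos : 0 < A := by
    have : -K < Real.sqrt (K ^ 2 + 4 * C₀) := Real.lt_sqrt_of_sq_lt (by nlinarith)
    rw [hA]; apply div_pos <;> linarith
  clear_value A
  have hK' : K = C₀ * A - A⁻¹ := by field_simp; linarith
  have hAi : 0 < A⁻¹ := inv_pos.2 hApos
  -- derivative of a
  have hd : ∀ τ ∈ Set.Ici (0:ℝ), HasDerivWithinAt a (a τ * m τ) (Set.Ici 0) τ := by
    intro τ hτ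
    have hp := hapos τ hτ
    have := (hda τ hτ).fun_inv (inv_pos.2 hp).ne'
    simp only [inv_inv] at this
    refine this.congr_deriv ?_
    field_simp
  have hac : ContinuousOn a (Set.Ici 0) := fun x hx => (hd x hx).continuousWithinAt
  -- conserved quantity
  have hcons : ∀ τ ∈ Set.Ici (0:ℝ), (a τ)⁻¹ * m τ + C₀ * a τ - (a τ)⁻¹ = K := by
    intro τ hτ
    have := aux_const (fun τ => (a τ)⁻¹ * m τ + C₀ * a τ - (a τ)⁻¹) _
      (fun x hx => ((hdam x hx).add ((hd x hx).const_mul C₀)).sub (hda x hx))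
      (fun x hx => by ring) τ hτ
    rw [this, ha0, hm0, hK]; ring
  have hm : ∀ τ ∈ Set.Ici (0:ℝ), m τ = (A - a τ) * (C₀ * a τ + A⁻¹) := by
    intro τ hτ
    have hp := (hapos τ hτ).ne'
    have h1 := hcons τ hτ
    have h2 : m τ = a τ * K - C₀ * a τ ^ 2 + 1 := by
      rw [← h1]; field_simp; ring
    have h3 : A * A⁻¹ = 1 := mul_inv_cancel₀ hApos.ne'
    rw [h2, hK']; linear_combination - h3
  have hdu : ∀ τ ∈ Set.Ici (0:ℝ), HasDerivWithinAt (fun t => A - a t)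
      (-(a τ * (C₀ * a τ + A⁻¹)) * (A - a τ)) (Set.Ici 0) τ := by
    intro τ hτ
    refine ((hd τ hτ).const_sub A).congr_deriv ?_
    rw [hm τ hτ]; ring
  have hu0 : 0 < A - a 0 := by
    have h1 := hm 0 Set.self_mem_Ici
    rw [hm0] at h1
    rw [h1] at hm₀
    have := hapos 0 Set.self_mem_Ici
    exact pos_of_mul_pos_left hm₀ (by positivity)
  have hu := aux_pos (fun t => A - a t) (fun τ => a τ * (C₀ * a τ + A⁻¹)) (by fun_prop) hdu hu0
  have hmpos : ∀ τ ∈ Set.Ici (0 : ℝ), 0 < m τ := by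
    intro τ hτ
    have := hapos τ hτ
    rw [hm τ hτ]
    exact mul_pos (hu τ hτ) (by positivity)
  have hmono : MonotoneOn a (Set.Ici (0 : ℝ)) := by
    intro x hx y hy hxy
    have := aux_anti (fun t => A - a t) _ hdu (fun τ hτ => by
      have := hapos τ hτ
      have := hu τ hτ
      rw [neg_mul, neg_nonpos]; positivity) hx hy hxy
    simp only at this
    linarith
  have hlim : Tendsto a atTop (nhds A) := by
    set c := a₀ * A⁻¹ with hc
    have hcpos : 0 < c := by positivity
    have hanti := aux_anti (fun t => (A - a t) * Real.exp (c * t)) _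
      (fun τ hτ => (hdu τ hτ).mul
        (((hasDerivAt_id τ).const_mul c).exp.hasDerivWithinAt)) (fun τ hτ => by
      have h1 := hapos τ hτ
      have h2 := hu τ hτ
      have h3 : a₀ ≤ a τ := ha0 ▸ hmono Set.self_mem_Ici hτ hτ
      have h4 : c ≤ a τ * (C₀ * a τ + A⁻¹) := by
        rw [hc]; apply mul_le_mul h3 _ hAi.le h1.le
        have : 0 < C₀ * a τ := by positivity
        linarith
      have h5 := Real.exp_pos (c * τ)
      have h6 : 0 ≤ (a τ * (C₀ * a τ + A⁻¹) - c) * ((A - a τ) * Real.exp (c * τ)) :=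
        mul_nonneg (by linarith) (by positivity)
      simp only [id]
      linarith)
    have hb : ∀ τ ∈ Set.Ici (0:ℝ), A - a τ ≤ (A - a 0) * Real.exp (-(c * τ)) := by
      intro τ hτ
      have := hanti Set.self_mem_Ici hτ hτ
      simp only [mul_zero, Real.exp_zero, mul_one] at this
      rw [Real.exp_neg, ← div_eq_mul_inv, le_div_iff₀ (Real.exp_pos _)]
      exact this
    have ht : Tendsto (fun τ => (A - a 0) * Real.exp (-(c * τ))) atTop (nhds 0) := by
      have := (Real.tendsto_exp_neg_atTop_nhds_zero.comp
        (tendsto_id.const_mul_atTop hcpos)).const_mul (A - a 0)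
      simpa using this
    have hz : Tendsto (fun τ => A - a τ) atTop (nhds 0) := by
      refine tendsto_of_tendsto_of_tendsto_of_le_of_le' tendsto_const_nhds ht ?_ ?_
      · filter_upwards [eventually_ge_atTop 0] with τ hτ using (hu τ hτ).le
      · filter_upwards [eventually_ge_atTop 0] with τ hτ using hb τ hτ
    simpa using hz.const_sub A
  refine ⟨hmpos, hmono, fun τ hτ => ⟨hapos τ hτ, by linarith [hu τ hτ]⟩, hlim, ?_⟩
  have : Tendsto (fun τ => (A - a τ) * (C₀ * a τ + A⁻¹)) atTop (nhds 0) := by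
    have := (hlim.const_sub A).mul ((hlim.const_mul C₀).add_const A⁻¹)
    simpa using this
  refine this.congr' ?_
  filter_upwards [eventually_ge_atTop 0] with τ hτ using (hm τ hτ).symm
end

section
/- Let X₀ < 0 and 0 < a₀ < −1/X₀, and let a : [0, ∞) → ℝ be differentiable with a(0) = a₀ and a′(τ) = X₀ a(τ)² + a(τ) for all τ ≥ 0. Then a is strictly increasing, 0 < a(τ) < −1/X₀ for all τ, a(τ) → −1/X₀ as τ → ∞, and the function m(τ) := 1 + X₀ a(τ) is strictly decreasing with m(τ) → 0 as τ → ∞. -/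
open Filter

/-- for `X₀ < 0` and `0 < a₀ < −1/X₀`, the solution of `a′ = X₀a² + a`,
`a(0) = a₀` on `[0, ∞)` is strictly increasing with `0 < a < −1/X₀`, `a → −1/X₀`,
and `m := 1 + X₀a` is strictly decreasing with `m → 0`. -/
theorem riccati_Xneg_asymptotics
    (X₀ a₀ : ℝ) (hX₀ : X₀ < 0) (ha₀ : 0 < a₀) (ha₀' : a₀ < -1 / X₀)
    (a : ℝ → ℝ) (ha0 : a 0 = a₀)
    (hda : ∀ τ ∈ Set.Ici (0 : ℝ),
      HasDerivWithinAt a (X₀ * (a τ) ^ 2 + a τ) (Set.Ici (0 : ℝ)) τ) :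
    StrictMonoOn a (Set.Ici (0 : ℝ)) ∧
    (∀ τ ∈ Set.Ici (0 : ℝ), 0 < a τ ∧ a τ < -1 / X₀) ∧
    Tendsto a atTop (nhds (-1 / X₀)) ∧
    StrictAntiOn (fun τ => 1 + X₀ * a τ) (Set.Ici (0 : ℝ)) ∧
    Tendsto (fun τ => 1 + X₀ * a τ) atTop (nhds 0) := by
  have const : ∀ f : ℝ → ℝ, (∀ t ∈ Set.Ici (0:ℝ), HasDerivWithinAt f 0 (Set.Ici 0) t) →
      ∀ t ∈ Set.Ici (0:ℝ), f t = f 0 := by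
    intro f hf t ht
    have h := Convex.norm_image_sub_le_of_norm_hasDerivWithin_le (C := 0) hf
      (fun x _ => by simp) (convex_Ici 0) (Set.self_mem_Ici) ht
    have h2 : ‖f t - f 0‖ = 0 := le_antisymm (by simpa using h) (norm_nonneg _)
    exact sub_eq_zero.1 (norm_eq_zero.1 h2)
  have hac : ContinuousOn a (Set.Ici 0) := fun t ht => (hda t ht).continuousWithinAt
  have hg : Continuous (fun t : ℝ => a (max t 0)) :=
    hac.comp_continuous (by fun_prop) (fun t => Set.mem_Ici.2 (le_max_right _ _))
  obtain ⟨F, hF0, hF⟩ : ∃ F : ℝ → ℝ, F 0 = 0 ∧ ∀ t ∈ Set.Ici (0:ℝ),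
      HasDerivWithinAt F (a t) (Set.Ici 0) t := by
    refine ⟨fun t => ∫ s in (0:ℝ)..t, a (max s 0), by simp, fun t ht => ?_⟩
    have h := (hg.integral_hasStrictDerivAt 0 t).hasDerivAt.hasDerivWithinAt (s := Set.Ici 0)
    rwa [max_eq_left (Set.mem_Ici.1 ht)] at h
  have hm0 : 0 < 1 + X₀ * a₀ := by
    have := (lt_div_iff_of_neg hX₀).1 ha₀'
    nlinarith
  have hA : ∀ t ∈ Set.Ici (0:ℝ), a t * Real.exp (-t - X₀ * F t) = a₀ := by
    intro t ht
    have := const (fun t => a t * Real.exp (-t - X₀ * F t)) (fun t ht => by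
      have h := (hda t ht).mul (((hasDerivWithinAt_id t _).neg.sub ((hF t ht).const_mul X₀)).exp)
      refine h.congr_deriv ?_
      simp only [id, Pi.neg_apply, Pi.sub_apply]
      ring) t ht
    simpa [hF0, ha0] using this
  have hM : ∀ t ∈ Set.Ici (0:ℝ), (1 + X₀ * a t) * Real.exp (- (X₀ * F t)) = 1 + X₀ * a₀ := by
    intro t ht
    have := const (fun t => (1 + X₀ * a t) * Real.exp (-(X₀ * F t))) (fun t ht => by
      have h := (((hda t ht).const_mul X₀).const_add 1).mul (((hF t ht).const_mul X₀).neg.exp)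
      refine h.congr_deriv ?_
      simp only [Pi.neg_apply]
      ring) t ht
    simpa [hF0, ha0] using this
  have hD : ∀ t : ℝ, 0 < 1 + X₀ * a₀ - X₀ * a₀ * Real.exp t := by
    intro t
    have := mul_pos (mul_pos (neg_pos.2 hX₀) ha₀) (Real.exp_pos t)
    linarith
  have key : ∀ t ∈ Set.Ici (0:ℝ), 1 + X₀ * a t =
      (1 + X₀ * a₀) / (1 + X₀ * a₀ - X₀ * a₀ * Real.exp t) := by
    intro t ht
    rw [eq_div_iff (hD t).ne']
    have h1 := hA t ht
    have h2 := hM t ht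
    have e1 : Real.exp (-t - X₀ * F t) * Real.exp t = Real.exp (-(X₀ * F t)) := by
      rw [← Real.exp_add]; congr 1; ring
    have h3 : a₀ * Real.exp t = a t * Real.exp (-(X₀ * F t)) := by
      rw [← h1, mul_assoc, e1]
    have h4 : (1 + X₀ * a₀) * a t = (1 + X₀ * a t) * (a₀ * Real.exp t) := by
      rw [h3, ← h2]; ring
    linear_combination (-X₀) * h4 * (-1)
  have hapos : ∀ t ∈ Set.Ici (0:ℝ), 0 < a t := fun t ht =>
    pos_of_mul_pos_left (by rw [hA t ht]; exact ha₀) (Real.exp_pos _).le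
  have hmpos : ∀ t ∈ Set.Ici (0:ℝ), 0 < 1 + X₀ * a t := fun t ht => by
    rw [key t ht]; exact div_pos hm0 (hD t)
  have hanti : StrictAntiOn (fun τ => 1 + X₀ * a τ) (Set.Ici (0 : ℝ)) := by
    intro s hs t ht hst
    simp only
    rw [key s hs, key t ht]
    apply div_lt_div_of_pos_left hm0 (hD s)
    have := mul_lt_mul_of_pos_left (Real.exp_lt_exp.2 hst) (mul_pos (neg_pos.2 hX₀) ha₀)
    linarith
  have hlim : Tendsto (fun τ => 1 + X₀ * a τ) atTop (nhds 0) := by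
    have h : Tendsto (fun t => (1 + X₀ * a₀) / (1 + X₀ * a₀ + (-X₀ * a₀) * Real.exp t))
        atTop (nhds 0) :=
      Tendsto.const_div_atTop (tendsto_atTop_add_const_left _ _
        (Real.tendsto_exp_atTop.const_mul_atTop (mul_pos (neg_pos.2 hX₀) ha₀))) _
    refine h.congr' ?_
    filter_upwards [eventually_ge_atTop 0] with t ht
    rw [key t ht]; congr 1; ring
  refine ⟨?_, ?_, ?_, hanti, hlim⟩
  · intro s hs t ht hst
    have := hanti hs ht hst
    simp only at this
    nlinarith
  · intro t ht
    refine ⟨hapos t ht, ?_⟩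
    rw [lt_div_iff_of_neg hX₀]
    linarith [hmpos t ht]
  · have h := (hlim.sub_const 1).div_const X₀
    rw [zero_sub] at h
    refine h.congr fun t => ?_
    rw [div_eq_iff hX₀.ne]
    ring
end

section
/- Let k ∈ (0,1), α := (3k² + 1)/4, and t₀ ≤ t* < 0. Let a : [t₀, t*] × ℝ → ℝ be continuous, positive, 1-periodic in the second variable θ, and nondecreasing in the first (time) variable; let μ̃ ≥ 0 and v, with |v| < 1, be continuous functions on [t₀, t*] × ℝ, 1-periodic in θ. Define h₁^M := a⁻¹ μ̃ (1 + k²v²)/(1 − v²). Assume that for every τ ∈ [t₀, t*], ∫₀¹ |τ| h₁^M(τ, θ) dθ ≤ (t₀/τ)^α ∫₀¹ |t₀| h₁^M(t₀, θ) dθ. Then (∫₀¹ a(t*, θ)⁻¹ dθ) · inf_{θ ∈ [0,1]} ∫_{t₀}^{t*} |τ| μ̃(τ, θ)/(1 − v(τ, θ)²) dτ ≤ (|t₀|²/(1 − α)) (1 − (t*/t₀)^{1−α}) ∫₀¹ h₁^M(t₀, θ) dθ. -/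
open MeasureTheory

/-- The matter energy density `h₁^M = a⁻¹ μ̃ (1 + k²v²)/(1 − v²)` (curried in `(t, θ)`). -/
noncomputable def matterDensity (k : ℝ) (a μ v : ℝ → ℝ → ℝ) (t θ : ℝ) : ℝ :=
  (a t θ)⁻¹ * μ t θ * (1 + k ^ 2 * (v t θ) ^ 2) / (1 - (v t θ) ^ 2)

theorem avg_core_integral (α t₀ tstar : ℝ) (hα : α < 1)
    (ht₀ : t₀ ≤ tstar) (htstar : tstar < 0) :
    IntervalIntegrable (fun τ => (t₀ / τ) ^ α) volume t₀ tstar ∧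
    ∫ τ in t₀..tstar, (t₀ / τ) ^ α = |t₀| / (1 - α) * (1 - (tstar / t₀) ^ (1 - α)) := by
  have h0 : t₀ < 0 := lt_of_le_of_lt ht₀ htstar
  have hneg : ∀ τ ∈ Set.uIcc t₀ tstar, τ < 0 := by
    intro τ hτ
    rw [Set.uIcc_of_le ht₀] at hτ
    exact lt_of_le_of_lt hτ.2 htstar
  have hint : IntervalIntegrable (fun τ => (t₀ / τ) ^ α) volume t₀ tstar := by
    apply ContinuousOn.intervalIntegrable
    apply ContinuousOn.rpow_const
    · exact continuousOn_const.div continuousOn_id (fun τ hτ => (hneg τ hτ).ne)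
    · intro τ hτ
      exact Or.inl (div_pos_of_neg_of_neg h0 (hneg τ hτ)).ne'
  refine ⟨hint, ?_⟩
  rw [intervalIntegral.integral_eq_sub_of_hasDerivAt
    (f := fun τ => t₀ / (1 - α) * (τ / t₀) ^ (1 - α)) _ hint]
  · rw [div_self h0.ne, Real.one_rpow, abs_of_neg h0]
    ring
  · intro τ hτ
    have hp : 0 < τ / t₀ := div_pos_of_neg_of_neg (hneg τ hτ) h0
    have h1 := (((hasDerivAt_id τ).div_const t₀).rpow_const (p := 1 - α)
      (Or.inl hp.ne')).const_mul (t₀ / (1 - α))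
    refine h1.congr_deriv ?_
    symm
    have : (t₀ / τ) = (τ / t₀)⁻¹ := by rw [inv_div]
    rw [this, Real.inv_rpow hp.le, ← Real.rpow_neg hp.le]
    have h2 : (1 - α - 1) = -α := by ring
    have h3 : 1 - α ≠ 0 := by linarith
    simp only [id, h2]
    field_simp
    exact (div_self h0.ne).symm

theorem avg_core
    (k α t₀ tstar : ℝ) (hk : k ∈ Set.Ioo (0 : ℝ) 1) (hα : α = (3 * k ^ 2 + 1) / 4)
    (ht₀ : t₀ ≤ tstar) (htstar : tstar < 0)
    (a μ v : ℝ → ℝ → ℝ)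
    (ha_cont : Continuous (Function.uncurry a))
    (ha_pos : ∀ t, ∀ θ : ℝ, 0 < a t θ)
    (ha_mono : ∀ θ : ℝ, ∀ t ∈ Set.Icc t₀ tstar, a t θ ≤ a tstar θ)
    (hμ_cont : Continuous (Function.uncurry μ))
    (hμ_nonneg : ∀ t, ∀ θ : ℝ, 0 ≤ μ t θ)
    (hv_cont : Continuous (Function.uncurry v))
    (hv_lt : ∀ t, ∀ θ : ℝ, |v t θ| < 1)
    (h_energy : ∀ τ ∈ Set.Icc t₀ tstar,
      (∫ θ in (0 : ℝ)..1, |τ| * matterDensity k a μ v τ θ) ≤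
        (t₀ / τ) ^ α * ∫ θ in (0 : ℝ)..1, |t₀| * matterDensity k a μ v t₀ θ) :
    (∫ θ in (0 : ℝ)..1, (a tstar θ)⁻¹) *
      sInf ((fun θ => ∫ τ in t₀..tstar, |τ| * μ τ θ / (1 - (v τ θ) ^ 2)) ''
        Set.Icc (0 : ℝ) 1) ≤
    (|t₀| ^ 2 / (1 - α)) * (1 - (tstar / t₀) ^ (1 - α)) *
      ∫ θ in (0 : ℝ)..1, matterDensity k a μ v t₀ θ := by
  have hα1 : α < 1 := by
    have := hk.1; have := hk.2; rw [hα]; nlinarith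
  obtain ⟨hint, hval⟩ := avg_core_integral α t₀ tstar hα1 ht₀ htstar
  have hv2 : ∀ t θ, 0 < 1 - (v t θ) ^ 2 := fun t θ => by
    have := (sq_lt_one_iff_abs_lt_one (v t θ)).2 (hv_lt t θ)
    linarith
  set F : ℝ → ℝ → ℝ := fun τ θ => |τ| * μ τ θ / (1 - (v τ θ) ^ 2) with hF
  have hFc : Continuous (Function.uncurry F) :=
    (continuous_fst.abs.mul hμ_cont).div (continuous_const.sub (hv_cont.pow 2))
      (fun x => (hv2 x.1 x.2).ne')
  have hF0 : ∀ τ θ, 0 ≤ F τ θ := fun τ θ =>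
    div_nonneg (mul_nonneg (abs_nonneg _) (hμ_nonneg _ _)) (hv2 _ _).le
  have hHc : Continuous (Function.uncurry (fun τ θ => |τ| * matterDensity k a μ v τ θ)) :=
    continuous_fst.abs.mul ((((ha_cont.inv₀ (fun x => (ha_pos x.1 x.2).ne')).mul hμ_cont).mul
      (continuous_const.add (continuous_const.mul (hv_cont.pow 2)))).div
        (continuous_const.sub (hv_cont.pow 2)) (fun x => (hv2 x.1 x.2).ne'))
  have hAc : Continuous (fun θ => (a tstar θ)⁻¹) :=
    (ha_cont.comp (continuous_const.prodMk continuous_id)).inv₀ (fun θ => (ha_pos tstar θ).ne')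
  have hA0 : ∀ θ, 0 ≤ (a tstar θ)⁻¹ := fun θ => (inv_pos.2 (ha_pos _ _)).le
  have hIc : Continuous (fun θ => ∫ τ in t₀..tstar, F τ θ) :=
    intervalIntegral.continuous_parametric_intervalIntegral_of_continuous'
      (f := fun θ τ => F τ θ) (hFc.comp continuous_swap) _ _
  have hGc : Continuous (Function.uncurry (fun τ θ => (a tstar θ)⁻¹ * F τ θ)) :=
    (hAc.comp continuous_snd).mul hFc
  set m := sInf ((fun θ => ∫ τ in t₀..tstar, F τ θ) '' Set.Icc (0 : ℝ) 1) with hm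
  have hmle : ∀ θ ∈ Set.Icc (0:ℝ) 1, m ≤ ∫ τ in t₀..tstar, F τ θ := fun θ hθ =>
    csInf_le (isCompact_Icc.image hIc).bddBelow ⟨θ, hθ, rfl⟩
  have hcomp : ∀ τ ∈ Set.Icc t₀ tstar, ∀ θ,
      (a tstar θ)⁻¹ * F τ θ ≤ |τ| * matterDensity k a μ v τ θ := by
    intro τ hτ θ
    have e : |τ| * matterDensity k a μ v τ θ
        = (a τ θ)⁻¹ * F τ θ * (1 + k ^ 2 * (v τ θ) ^ 2) := by
      simp only [matterDensity, hF]; ring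
    rw [e]
    have h1 : (a tstar θ)⁻¹ ≤ (a τ θ)⁻¹ := inv_anti₀ (ha_pos _ _) (ha_mono θ τ hτ)
    have h2 := mul_le_mul_of_nonneg_right h1 (hF0 τ θ)
    have h3 : 0 ≤ (a τ θ)⁻¹ * F τ θ := mul_nonneg (inv_pos.2 (ha_pos _ _)).le (hF0 _ _)
    have h4 : 0 ≤ k ^ 2 * (v τ θ) ^ 2 := by positivity
    nlinarith [mul_nonneg h3 h4]
  have hGθ : ∀ τ, Continuous (fun θ => (a tstar θ)⁻¹ * F τ θ) := fun τ =>
    hGc.comp (continuous_const.prodMk continuous_id)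
  have hHθ : ∀ τ, Continuous (fun θ => |τ| * matterDensity k a μ v τ θ) := fun τ =>
    hHc.comp (continuous_const.prodMk continuous_id)
  calc (∫ θ in (0 : ℝ)..1, (a tstar θ)⁻¹) * m
      = ∫ θ in (0 : ℝ)..1, (a tstar θ)⁻¹ * m := by
        rw [intervalIntegral.integral_mul_const]
    _ ≤ ∫ θ in (0 : ℝ)..1, (a tstar θ)⁻¹ * ∫ τ in t₀..tstar, F τ θ := by
        apply intervalIntegral.integral_mono_on zero_le_one
          ((hAc.mul continuous_const).intervalIntegrable _ _)
          ((hAc.mul hIc).intervalIntegrable _ _)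
        intro θ hθ
        exact mul_le_mul_of_nonneg_left (hmle θ hθ) (hA0 θ)
    _ = ∫ θ in (0 : ℝ)..1, ∫ τ in t₀..tstar, (a tstar θ)⁻¹ * F τ θ := by
        simp only [intervalIntegral.integral_const_mul]
    _ = ∫ τ in t₀..tstar, ∫ θ in (0 : ℝ)..1, (a tstar θ)⁻¹ * F τ θ := by
        refine (intervalIntegral_intervalIntegral_swap ?_).symm
        exact (hGc.continuousOn.integrableOn_compact
          (isCompact_uIcc.prod isCompact_uIcc)).mono_set
          (Set.prod_mono Set.uIoc_subset_uIcc Set.uIoc_subset_uIcc)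
    _ ≤ ∫ τ in t₀..tstar, (t₀ / τ) ^ α * ∫ θ in (0 : ℝ)..1, |t₀| * matterDensity k a μ v t₀ θ := by
        apply intervalIntegral.integral_mono_on ht₀ _ (hint.mul_const _)
        · intro τ hτ
          refine le_trans ?_ (h_energy τ hτ)
          exact intervalIntegral.integral_mono_on zero_le_one ((hGθ τ).intervalIntegrable _ _)
            ((hHθ τ).intervalIntegrable _ _) (fun θ _ => hcomp τ hτ θ)
        · exact (intervalIntegral.continuous_parametric_intervalIntegral_of_continuous'
            hGc _ _).intervalIntegrable _ _
    _ = _ := by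
        rw [intervalIntegral.integral_mul_const, hval, intervalIntegral.integral_const_mul]
        ring

/-- lower bound for the time-averaged mass-energy density
(Lemma 3.2 of the paper). -/
theorem averaged_density_lower_bound
    (k α t₀ tstar : ℝ) (hk : k ∈ Set.Ioo (0 : ℝ) 1) (hα : α = (3 * k ^ 2 + 1) / 4)
    (ht₀ : t₀ ≤ tstar) (htstar : tstar < 0)
    (a μ v : ℝ → ℝ → ℝ)
    (ha_cont : ContinuousOn (Function.uncurry a) (Set.Icc t₀ tstar ×ˢ Set.univ))
    (ha_pos : ∀ t ∈ Set.Icc t₀ tstar, ∀ θ : ℝ, 0 < a t θ)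
    (ha_per : ∀ t ∈ Set.Icc t₀ tstar, ∀ θ : ℝ, a t (θ + 1) = a t θ)
    (ha_mono : ∀ θ : ℝ, MonotoneOn (fun t => a t θ) (Set.Icc t₀ tstar))
    (hμ_cont : ContinuousOn (Function.uncurry μ) (Set.Icc t₀ tstar ×ˢ Set.univ))
    (hμ_nonneg : ∀ t ∈ Set.Icc t₀ tstar, ∀ θ : ℝ, 0 ≤ μ t θ)
    (hμ_per : ∀ t ∈ Set.Icc t₀ tstar, ∀ θ : ℝ, μ t (θ + 1) = μ t θ)
    (hv_cont : ContinuousOn (Function.uncurry v) (Set.Icc t₀ tstar ×ˢ Set.univ))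
    (hv_lt : ∀ t ∈ Set.Icc t₀ tstar, ∀ θ : ℝ, |v t θ| < 1)
    (hv_per : ∀ t ∈ Set.Icc t₀ tstar, ∀ θ : ℝ, v t (θ + 1) = v t θ)
    (h_energy : ∀ τ ∈ Set.Icc t₀ tstar,
      (∫ θ in (0 : ℝ)..1, |τ| * matterDensity k a μ v τ θ) ≤
        (t₀ / τ) ^ α * ∫ θ in (0 : ℝ)..1, |t₀| * matterDensity k a μ v t₀ θ) :
    (∫ θ in (0 : ℝ)..1, (a tstar θ)⁻¹) *
      sInf ((fun θ => ∫ τ in t₀..tstar, |τ| * μ τ θ / (1 - (v τ θ) ^ 2)) ''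
        Set.Icc (0 : ℝ) 1) ≤
    (|t₀| ^ 2 / (1 - α)) * (1 - (tstar / t₀) ^ (1 - α)) *
      ∫ θ in (0 : ℝ)..1, matterDensity k a μ v t₀ θ := by
  obtain ⟨p, hpc, hpm, hpe⟩ : ∃ p : ℝ → ℝ, Continuous p ∧ (∀ t, p t ∈ Set.Icc t₀ tstar) ∧
      ∀ t ∈ Set.Icc t₀ tstar, p t = t := by
    refine ⟨fun t => max t₀ (min t tstar), by fun_prop, fun t => ⟨le_max_left _ _,
      max_le ht₀ (min_le_right _ _)⟩, fun t ht => ?_⟩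
    simp [min_eq_left ht.2, max_eq_right ht.1]
  have hl : p t₀ = t₀ := hpe _ ⟨le_rfl, ht₀⟩
  have hr : p tstar = tstar := hpe _ ⟨ht₀, le_rfl⟩
  have hc : ∀ f : ℝ → ℝ → ℝ, ContinuousOn (Function.uncurry f) (Set.Icc t₀ tstar ×ˢ Set.univ) →
      Continuous (Function.uncurry (fun t θ => f (p t) θ)) := fun f hf =>
    hf.comp_continuous (f := fun x : ℝ × ℝ => (p x.1, x.2))
      ((hpc.comp continuous_fst).prodMk continuous_snd) (fun x => ⟨hpm _, trivial⟩)
  have hmd : ∀ τ ∈ Set.Icc t₀ tstar, ∀ θ, matterDensity k (fun t θ => a (p t) θ)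
      (fun t θ => μ (p t) θ) (fun t θ => v (p t) θ) τ θ = matterDensity k a μ v τ θ := by
    intro τ hτ θ
    simp only [matterDensity, hpe τ hτ]
  have key := avg_core k α t₀ tstar hk hα ht₀ htstar (fun t θ => a (p t) θ)
      (fun t θ => μ (p t) θ) (fun t θ => v (p t) θ) (hc a ha_cont)
      (fun t θ => ha_pos _ (hpm t) θ)
      (fun θ t ht => ha_mono θ (hpm t) (hpm tstar) (by rw [hpe t ht, hr]; exact ht.2))
      (hc μ hμ_cont) (fun t θ => hμ_nonneg _ (hpm t) θ) (hc v hv_cont)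
      (fun t θ => hv_lt _ (hpm t) θ)
      (fun τ hτ => by
        simp only [hmd τ hτ, hmd t₀ ⟨le_rfl, ht₀⟩]
        exact h_energy τ hτ)
  simp only [hmd t₀ ⟨le_rfl, ht₀⟩, hr] at key
  have hI : (fun θ => ∫ τ in t₀..tstar, |τ| * μ (p τ) θ / (1 - (v (p τ) θ) ^ 2))
      = (fun θ => ∫ τ in t₀..tstar, |τ| * μ τ θ / (1 - (v τ θ) ^ 2)) := by
    funext θ
    apply intervalIntegral.integral_congr
    intro τ hτ
    rw [Set.uIcc_of_le ht₀] at hτ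
    simp only [hpe τ hτ]
  rw [hI] at key
  exact key
end

section
/- Let U, A : ℝ → ℝ be continuously differentiable 1-periodic functions and write ⟨A⟩ := ∫₀¹ A(σ) dσ. Then for every θ ∈ ℝ, e^{2U(θ)} |A(θ) − ⟨A⟩| ≤ (∫₀¹ e^{2U(σ)} |A′(σ)| dσ) · exp(2 ∫₀¹ |U′(σ)| dσ). The same inequality holds with U(θ) replaced by ⟨U⟩ := ∫₀¹ U(σ) dσ on the left-hand side. -/
open MeasureTheory

lemma osc_aux (f : ℝ → ℝ) (hf : ContDiff ℝ 1 f) (x y : ℝ) (hx : x ∈ Set.Icc (0:ℝ) 1)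
    (hy : y ∈ Set.Icc (0:ℝ) 1) : |f x - f y| ≤ ∫ σ in (0 : ℝ)..1, |deriv f σ| := by
  have hc : Continuous (deriv f) := hf.continuous_deriv le_rfl
  wlog h : y ≤ x generalizing x y
  · rw [abs_sub_comm]
    exact this y x hy hx (le_of_not_ge h)
  have e : ∫ σ in y..x, deriv f σ = f x - f y :=
    intervalIntegral.integral_deriv_eq_sub (fun z _ => hf.differentiable (by norm_num) z)
      (hc.intervalIntegrable _ _)
  rw [← e]
  refine (intervalIntegral.abs_integral_le_integral_abs h).trans ?_
  exact intervalIntegral.integral_mono_interval hy.1 h hx.2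
    (Filter.Eventually.of_forall fun z => abs_nonneg _) (hc.abs.intervalIntegrable _ _)

lemma mean_aux (f : ℝ → ℝ) (hf : ContDiff ℝ 1 f) (x : ℝ) (hx : x ∈ Set.Icc (0:ℝ) 1) :
    |f x - ∫ σ in (0 : ℝ)..1, f σ| ≤ ∫ σ in (0 : ℝ)..1, |deriv f σ| := by
  have e : f x - ∫ σ in (0 : ℝ)..1, f σ = ∫ σ in (0 : ℝ)..1, (f x - f σ) := by
    rw [intervalIntegral.integral_sub (by simp) (hf.continuous.intervalIntegrable _ _)]
    simp
  rw [e]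
  have := intervalIntegral.norm_integral_le_of_norm_le_const (a := (0:ℝ)) (b := 1)
    (f := fun σ => f x - f σ) (C := ∫ σ in (0 : ℝ)..1, |deriv f σ|) (by
      intro z hz
      rw [Set.uIoc_of_le zero_le_one] at hz
      exact osc_aux f hf x z hx ⟨hz.1.le, hz.2⟩)
  simpa using this

lemma main_aux (U A : ℝ → ℝ) (hU : ContDiff ℝ 1 U) (hA : ContDiff ℝ 1 A) (x c I : ℝ)
    (hx : x ∈ Set.Icc (0:ℝ) 1) (hc : ∀ σ ∈ Set.Icc (0:ℝ) 1, c ≤ U σ + I) :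
    Real.exp (2 * c) * |A x - ∫ σ in (0 : ℝ)..1, A σ| ≤
        (∫ σ in (0 : ℝ)..1, Real.exp (2 * U σ) * |deriv A σ|) * Real.exp (2 * I) := by
  have hd : Continuous (deriv A) := hA.continuous_deriv le_rfl
  have hu := hU.continuous
  refine (mul_le_mul_of_nonneg_left (mean_aux A hA x hx) (Real.exp_pos _).le).trans ?_
  rw [← intervalIntegral.integral_const_mul, ← intervalIntegral.integral_mul_const]
  refine intervalIntegral.integral_mono_on zero_le_one
    (Continuous.intervalIntegrable (by fun_prop) _ _)
    (Continuous.intervalIntegrable (by fun_prop) _ _) ?_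
  intro z hz
  rw [mul_right_comm, ← Real.exp_add]
  refine mul_le_mul_of_nonneg_right (Real.exp_le_exp.2 ?_) (abs_nonneg _)
  linarith [hc z hz]

/-- the pointwise oscillation estimate (3.12):
`e^{2U(θ)}|A(θ) − ⟨A⟩| ≤ (∫₀¹ e^{2U}|A′|) exp(2∫₀¹|U′|)`, and the same with `U(θ)`
replaced by the mean `⟨U⟩`. -/
theorem pointwise_oscillation_estimate
    (U A : ℝ → ℝ) (hU : ContDiff ℝ 1 U) (hA : ContDiff ℝ 1 A)
    (hU_per : ∀ θ, U (θ + 1) = U θ) (hA_per : ∀ θ, A (θ + 1) = A θ) :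
    ∀ θ : ℝ,
      Real.exp (2 * U θ) * |A θ - ∫ σ in (0 : ℝ)..1, A σ| ≤
        (∫ σ in (0 : ℝ)..1, Real.exp (2 * U σ) * |deriv A σ|) *
          Real.exp (2 * ∫ σ in (0 : ℝ)..1, |deriv U σ|) ∧
      Real.exp (2 * ∫ σ in (0 : ℝ)..1, U σ) * |A θ - ∫ σ in (0 : ℝ)..1, A σ| ≤
        (∫ σ in (0 : ℝ)..1, Real.exp (2 * U σ) * |deriv A σ|) *
          Real.exp (2 * ∫ σ in (0 : ℝ)..1, |deriv U σ|) := by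
  intro θ
  have hx : Int.fract θ ∈ Set.Icc (0:ℝ) 1 := ⟨Int.fract_nonneg _, (Int.fract_lt_one _).le⟩
  have key : ∀ f : ℝ → ℝ, (∀ θ, f (θ + 1) = f θ) → f θ = f (Int.fract θ) := by
    intro f hf
    have hp : Function.Periodic f 1 := hf
    have := hp.sub_int_mul_eq (x := θ) ⌊θ⌋
    rw [mul_one] at this
    exact this.symm
  rw [key U hU_per, key A hA_per]
  constructor
  · refine main_aux U A hU hA _ _ _ hx fun σ hσ => ?_
    linarith [(abs_le.1 (osc_aux U hU _ σ hx hσ)).2]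
  · refine main_aux U A hU hA _ _ _ hx fun σ hσ => ?_
    linarith [(abs_le.1 (mean_aux U hU σ hσ)).1]
end

section
/- Fix t < 0. Let a : ℝ → ℝ be continuous, positive and 1-periodic, let U, A : ℝ → ℝ be continuously differentiable and 1-periodic, and let P, Q : ℝ → ℝ be continuous and 1-periodic. Define E₁ := ∫₀¹ a⁻¹[(P − 1/(2t))² + a²(U′)² + (e^{4U}/(4t²))(Q² + a²(A′)²)] dθ and Ê₁ := 4E₁ ∫₀¹ a⁻¹ dθ. If ∫₀¹ a⁻¹ e^{4U} Q dθ = 0, then (∫₀¹ a⁻¹ [t⁻¹ e^{4U} Q A − (2tP − 1)] dθ)² ≤ t² Ê₁ (1 + Ê₁^{1/2} exp(Ê₁^{1/2}))². -/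
open MeasureTheory

/-- The energy `E₁ = ∫₀¹ a⁻¹[(P − 1/(2t))² + a²U′² + (e^{4U}/(4t²))(Q² + a²A′²)] dθ`. -/
noncomputable def energyE1 (t : ℝ) (a U A P Q : ℝ → ℝ) : ℝ :=
  ∫ θ in (0 : ℝ)..1,
    (a θ)⁻¹ * ((P θ - 1 / (2 * t)) ^ 2 + (a θ) ^ 2 * (deriv U θ) ^ 2 +
      (Real.exp (4 * U θ) / (4 * t ^ 2)) * ((Q θ) ^ 2 + (a θ) ^ 2 * (deriv A θ) ^ 2))

/-- The rescaled energy `Ê₁ = 4E₁ ∫₀¹ a⁻¹ dθ`. -/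
noncomputable def energyEhat (t : ℝ) (a U A P Q : ℝ → ℝ) : ℝ :=
  4 * energyE1 t a U A P Q * ∫ θ in (0 : ℝ)..1, (a θ)⁻¹

lemma weighted_cs (w h : ℝ → ℝ) (hw : Continuous w) (hwp : ∀ x, 0 < w x) (hh : Continuous h) :
    (∫ x in (0 : ℝ)..1, w x * h x) ^ 2 ≤
      (∫ x in (0 : ℝ)..1, w x) * ∫ x in (0 : ℝ)..1, w x * h x ^ 2 := by
  set I := ∫ x in (0 : ℝ)..1, w x with hI
  set M := ∫ x in (0 : ℝ)..1, w x * h x with hM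
  set N := ∫ x in (0 : ℝ)..1, w x * h x ^ 2 with hN
  have hIpos : 0 < I := by
    apply intervalIntegral.intervalIntegral_pos_of_pos (hw.intervalIntegrable _ _) hwp one_pos
  have h0 : 0 ≤ ∫ x in (0 : ℝ)..1, w x * (I * h x - M) ^ 2 := by
    apply intervalIntegral.integral_nonneg zero_le_one
    intro x _
    exact mul_nonneg (hwp x).le (sq_nonneg _)
  have h1 : (∫ x in (0 : ℝ)..1, w x * (I * h x - M) ^ 2) = I ^ 2 * N - 2 * I * M * M + M ^ 2 * I := by
    have : (fun x => w x * (I * h x - M) ^ 2) =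
        fun x => I ^ 2 * (w x * h x ^ 2) - 2 * I * M * (w x * h x) + M ^ 2 * w x := by
      funext x; ring
    rw [this, intervalIntegral.integral_add, intervalIntegral.integral_sub,
      intervalIntegral.integral_const_mul, intervalIntegral.integral_const_mul,
      intervalIntegral.integral_const_mul]
    all_goals exact Continuous.intervalIntegrable (by fun_prop) _ _
  rw [h1] at h0
  have h2 : 0 ≤ I * (I * N - M ^ 2) := by nlinarith
  have := nonneg_of_mul_nonneg_right h2 hIpos
  linarith

/-- the key fixed-time estimate in the case `𝒟 > 0`: if the conserved
quantity `ℬ` vanishes (i.e. `∫₀¹ a⁻¹e^{4U}Q dθ = 0`), then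
`𝒜² ≤ t²Ê₁(1 + Ê₁^{1/2} exp(Ê₁^{1/2}))²`. -/
theorem invariant_estimate_Dpos
    (t : ℝ) (ht : t < 0) (a U A P Q : ℝ → ℝ)
    (ha_cont : Continuous a) (ha_pos : ∀ θ, 0 < a θ) (ha_per : ∀ θ, a (θ + 1) = a θ)
    (hU : ContDiff ℝ 1 U) (hU_per : ∀ θ, U (θ + 1) = U θ)
    (hA : ContDiff ℝ 1 A) (hA_per : ∀ θ, A (θ + 1) = A θ)
    (hP : Continuous P) (hP_per : ∀ θ, P (θ + 1) = P θ)
    (hQ : Continuous Q) (hQ_per : ∀ θ, Q (θ + 1) = Q θ)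
    (hB : (∫ θ in (0 : ℝ)..1, (a θ)⁻¹ * Real.exp (4 * U θ) * Q θ) = 0) :
    (∫ θ in (0 : ℝ)..1,
        (a θ)⁻¹ * (t⁻¹ * Real.exp (4 * U θ) * Q θ * A θ - (2 * t * P θ - 1))) ^ 2 ≤
      t ^ 2 * energyEhat t a U A P Q *
        (1 + Real.sqrt (energyEhat t a U A P Q) *
          Real.exp (Real.sqrt (energyEhat t a U A P Q))) ^ 2 := by
  have hdU : Continuous (deriv U) := hU.continuous_deriv le_rfl
  have hdA : Continuous (deriv A) := hA.continuous_deriv le_rfl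
  have hUc : Continuous U := hU.continuous
  have hAc : Continuous A := hA.continuous
  have hw : Continuous (fun θ => (a θ)⁻¹) := ha_cont.inv₀ (fun θ => (ha_pos θ).ne')
  have hwp : ∀ θ, 0 < (a θ)⁻¹ := fun θ => inv_pos.2 (ha_pos θ)
  have ht0 : t ≠ 0 := ht.ne
  set s := Real.sqrt (energyEhat t a U A P Q) with hs
  have hs0 : 0 ≤ s := Real.sqrt_nonneg _
  let e : ℝ → ℝ := fun θ => (P θ - 1 / (2 * t)) ^ 2 + (a θ) ^ 2 * (deriv U θ) ^ 2 +
      (Real.exp (4 * U θ) / (4 * t ^ 2)) * ((Q θ) ^ 2 + (a θ) ^ 2 * (deriv A θ) ^ 2)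
  have hec : Continuous e := by fun_prop
  have hE : energyE1 t a U A P Q = ∫ θ in (0 : ℝ)..1, (a θ)⁻¹ * e θ := rfl
  have hIpos : 0 < ∫ θ in (0 : ℝ)..1, (a θ)⁻¹ :=
    intervalIntegral.intervalIntegral_pos_of_pos (hw.intervalIntegrable _ _) hwp one_pos
  have hE0 : 0 ≤ energyE1 t a U A P Q := by
    rw [hE]
    apply intervalIntegral.integral_nonneg zero_le_one
    intro x _
    have := hwp x
    simp only [e]
    positivity
  have hhat0 : 0 ≤ energyEhat t a U A P Q := by
    unfold energyEhat; positivity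
  have hss : s ^ 2 = energyEhat t a U A P Q := Real.sq_sqrt hhat0
  have key : ∀ (h : ℝ → ℝ) (c : ℝ), Continuous h → 0 ≤ c → (∀ θ, h θ ^ 2 ≤ 4 * c ^ 2 * e θ) →
      |∫ θ in (0 : ℝ)..1, (a θ)⁻¹ * h θ| ≤ c * s := by
    intro h c hh hc hle
    apply abs_le_of_sq_le_sq _ (by positivity)
    calc _ ≤ _ := weighted_cs _ h hw hwp hh
      _ ≤ (∫ θ in (0 : ℝ)..1, (a θ)⁻¹) * (4 * c ^ 2 * energyE1 t a U A P Q) := by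
        apply mul_le_mul_of_nonneg_left _ hIpos.le
        rw [hE, ← intervalIntegral.integral_const_mul]
        apply intervalIntegral.integral_mono_on zero_le_one
        · exact Continuous.intervalIntegrable (by fun_prop) _ _
        · exact Continuous.intervalIntegrable (by fun_prop) _ _
        · intro x _
          have := mul_le_mul_of_nonneg_left (hle x) (hwp x).le
          linarith
      _ = (c * s) ^ 2 := by
        rw [mul_pow, hss]; unfold energyEhat; ring
  have hexp : ∀ θ, Real.exp (4 * U θ) = Real.exp (2 * U θ) ^ 2 := by
    intro θ; rw [← Real.exp_nat_mul]; congr 1; push_cast; ring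
  have k1 : |∫ θ in (0 : ℝ)..1, (a θ)⁻¹ * (P θ - 1 / (2 * t))| ≤ 1 / 2 * s := by
    apply key _ _ (by fun_prop) (by norm_num)
    intro θ
    have : 0 ≤ (a θ) ^ 2 * (deriv U θ) ^ 2 +
      (Real.exp (4 * U θ) / (4 * t ^ 2)) * ((Q θ) ^ 2 + (a θ) ^ 2 * (deriv A θ) ^ 2) := by positivity
    simp only [e]; linarith
  have k2 : (∫ θ in (0 : ℝ)..1, |deriv U θ|) ≤ 1 / 2 * s := by
    have := key (fun θ => a θ * |deriv U θ|) (1 / 2) (by fun_prop) (by norm_num) (by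
      intro θ
      have : 0 ≤ (P θ - 1 / (2 * t)) ^ 2 +
        (Real.exp (4 * U θ) / (4 * t ^ 2)) * ((Q θ) ^ 2 + (a θ) ^ 2 * (deriv A θ) ^ 2) := by
          positivity
      simp only [e, mul_pow, sq_abs]; linarith)
    refine le_trans (le_of_eq ?_) ((le_abs_self _).trans this)
    congr 1; funext θ; rw [inv_mul_cancel_left₀ (ha_pos θ).ne']
  have hte : ∀ θ, 4 * |t| ^ 2 * e θ = 4 * t ^ 2 * ((P θ - 1 / (2 * t)) ^ 2
      + (a θ) ^ 2 * (deriv U θ) ^ 2) +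
      Real.exp (2 * U θ) ^ 2 * ((Q θ) ^ 2 + (a θ) ^ 2 * (deriv A θ) ^ 2) := by
    intro θ
    simp only [e, sq_abs, hexp]
    field_simp
  have k3 : (∫ θ in (0 : ℝ)..1, (a θ)⁻¹ * (Real.exp (2 * U θ) * |Q θ|)) ≤ |t| * s := by
    refine (le_abs_self _).trans (key _ _ (by fun_prop) (abs_nonneg _) ?_)
    intro θ
    rw [hte, mul_pow, sq_abs]
    have : 0 ≤ 4 * t ^ 2 * ((P θ - 1 / (2 * t)) ^ 2 + (a θ) ^ 2 * (deriv U θ) ^ 2) +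
      Real.exp (2 * U θ) ^ 2 * ((a θ) ^ 2 * (deriv A θ) ^ 2) := by positivity
    linarith
  have k4 : (∫ θ in (0 : ℝ)..1, Real.exp (2 * U θ) * |deriv A θ|) ≤ |t| * s := by
    have := key (fun θ => a θ * (Real.exp (2 * U θ) * |deriv A θ|)) |t| (by fun_prop)
      (abs_nonneg _) (by
      intro θ
      rw [hte, mul_pow, mul_pow, sq_abs]
      have : 0 ≤ 4 * t ^ 2 * ((P θ - 1 / (2 * t)) ^ 2 + (a θ) ^ 2 * (deriv U θ) ^ 2) +
        Real.exp (2 * U θ) ^ 2 * (Q θ) ^ 2 := by positivity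
      linarith)
    refine le_trans (le_of_eq ?_) ((le_abs_self _).trans this)
    congr 1; funext θ; rw [inv_mul_cancel_left₀ (ha_pos θ).ne']
  -- oscillation of U
  have sub : ∀ (f : ℝ → ℝ), Continuous f → (∀ x, 0 ≤ f x) → ∀ x y, 0 ≤ x → x ≤ y → y ≤ 1 →
      (∫ θ in x..y, f θ) ≤ ∫ θ in (0 : ℝ)..1, f θ := by
    intro f hf hf0 x y hx hxy hy
    apply intervalIntegral.integral_mono_interval hx hxy hy
    · exact Filter.Eventually.of_forall hf0
    · exact hf.intervalIntegrable _ _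
  have osc : ∀ x ∈ Set.Icc (0 : ℝ) 1, ∀ y ∈ Set.Icc (0 : ℝ) 1, |U y - U x| ≤ 1 / 2 * s := by
    have main : ∀ x y, 0 ≤ x → x ≤ y → y ≤ 1 → |U y - U x| ≤ 1 / 2 * s := by
      intro x y hx hxy hy
      rw [← intervalIntegral.integral_deriv_eq_sub
        (fun z _ => (hU.differentiable one_ne_zero) z) (hdU.intervalIntegrable _ _)]
      refine (intervalIntegral.abs_integral_le_integral_abs hxy).trans ?_
      exact (sub _ hdU.abs (fun _ => abs_nonneg _) x y hx hxy hy).trans k2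
    intro x hx y hy
    rcases le_total x y with h | h
    · exact main x y hx.1 h hy.2
    · rw [abs_sub_comm]; exact main y x hy.1 h hx.2
  have hAb : ∀ x ∈ Set.Icc (0 : ℝ) 1,
      Real.exp (2 * U x) * |A x - A 0| ≤ Real.exp s * (|t| * s) := by
    intro x hx
    rw [← intervalIntegral.integral_deriv_eq_sub
        (fun z _ => (hA.differentiable one_ne_zero) z) (hdA.intervalIntegrable _ _)]
    calc _ ≤ Real.exp (2 * U x) * ∫ z in (0 : ℝ)..x, |deriv A z| :=
          mul_le_mul_of_nonneg_left (intervalIntegral.abs_integral_le_integral_abs hx.1)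
            (Real.exp_pos _).le
      _ ≤ Real.exp (2 * U x) * ∫ z in (0 : ℝ)..1, |deriv A z| :=
          mul_le_mul_of_nonneg_left
            (sub _ hdA.abs (fun _ => abs_nonneg _) 0 x le_rfl hx.1 hx.2) (Real.exp_pos _).le
      _ ≤ Real.exp s * ∫ z in (0 : ℝ)..1, Real.exp (2 * U z) * |deriv A z| := by
          rw [← intervalIntegral.integral_const_mul, ← intervalIntegral.integral_const_mul]
          apply intervalIntegral.integral_mono_on zero_le_one
          · exact Continuous.intervalIntegrable (by fun_prop) _ _
          · exact Continuous.intervalIntegrable (by fun_prop) _ _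
          · intro z hz
            rw [← mul_assoc, ← Real.exp_add]
            apply mul_le_mul_of_nonneg_right _ (abs_nonneg _)
            apply Real.exp_le_exp.2
            have := (abs_le.1 (osc z hz x hx)).2
            linarith
      _ ≤ _ := mul_le_mul_of_nonneg_left k4 (Real.exp_pos _).le
  have k5 : |∫ θ in (0 : ℝ)..1, (a θ)⁻¹ * Real.exp (4 * U θ) * Q θ * (A θ - A 0)| ≤
      Real.exp s * (|t| * s) * (|t| * s) := by
    refine (intervalIntegral.abs_integral_le_integral_abs zero_le_one).trans ?_
    refine le_trans ?_ (mul_le_mul_of_nonneg_left k3 (by positivity))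
    rw [← intervalIntegral.integral_const_mul]
    apply intervalIntegral.integral_mono_on zero_le_one
    · exact Continuous.intervalIntegrable (by fun_prop) _ _
    · exact Continuous.intervalIntegrable (by fun_prop) _ _
    · intro x hx
      rw [abs_mul, abs_mul, abs_mul, abs_of_pos (hwp x), abs_of_pos (Real.exp_pos _), hexp]
      have h1 : 0 ≤ (a x)⁻¹ * (Real.exp (2 * U x) * |Q x|) := by
        have := hwp x
        positivity
      have := mul_le_mul_of_nonneg_right (hAb x hx) h1
      refine le_trans (le_of_eq ?_) this
      ring
  have split : (∫ θ in (0 : ℝ)..1,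
        (a θ)⁻¹ * (t⁻¹ * Real.exp (4 * U θ) * Q θ * A θ - (2 * t * P θ - 1))) =
      t⁻¹ * (∫ θ in (0 : ℝ)..1, (a θ)⁻¹ * Real.exp (4 * U θ) * Q θ * (A θ - A 0))
      + t⁻¹ * A 0 * (∫ θ in (0 : ℝ)..1, (a θ)⁻¹ * Real.exp (4 * U θ) * Q θ)
      - 2 * t * ∫ θ in (0 : ℝ)..1, (a θ)⁻¹ * (P θ - 1 / (2 * t)) := by
    rw [← intervalIntegral.integral_const_mul, ← intervalIntegral.integral_const_mul,
      ← intervalIntegral.integral_const_mul, ← intervalIntegral.integral_add,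
      ← intervalIntegral.integral_sub]
    · congr 1; funext θ; field_simp; ring
    all_goals exact Continuous.intervalIntegrable (by fun_prop) _ _
  rw [split, hB, ← hss]
  have htp : 0 < |t| := abs_pos.2 ht0
  have fin : |t⁻¹ * (∫ θ in (0 : ℝ)..1, (a θ)⁻¹ * Real.exp (4 * U θ) * Q θ * (A θ - A 0))
      + t⁻¹ * A 0 * 0 - 2 * t * ∫ θ in (0 : ℝ)..1, (a θ)⁻¹ * (P θ - 1 / (2 * t))| ≤
      |t| * s * (1 + s * Real.exp s) := by
    rw [mul_zero, add_zero]
    refine (abs_sub _ _).trans ?_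
    rw [abs_mul, abs_mul, abs_mul, abs_inv, abs_two]
    have h1 := mul_le_mul_of_nonneg_left k5 (inv_pos.2 htp).le
    have h2 := mul_le_mul_of_nonneg_left k1 (by positivity : 0 ≤ 2 * |t|)
    refine (add_le_add h1 h2).trans (le_of_eq ?_)
    field_simp
    ring
  calc _ ≤ (|t| * s * (1 + s * Real.exp s)) ^ 2 := sq_le_sq' (abs_le.1 fin).1 (abs_le.1 fin).2
    _ = _ := by rw [mul_pow, mul_pow, sq_abs]
end

section
/- Fix t < 0. Let a : ℝ → ℝ be continuous, positive and 1-periodic, let U : ℝ → ℝ be continuously differentiable and 1-periodic, let A′ denote the derivative of a continuously differentiable 1-periodic function A, and let P, Q : ℝ → ℝ be continuous and 1-periodic. Define E₁ := ∫₀¹ a⁻¹[(P − 1/(2t))² + a²(U′)² + (e^{4U}/(4t²))(Q² + a²(A′)²)] dθ, Ê₁ := 4E₁ ∫₀¹ a⁻¹ dθ, and ⟨U⟩ := ∫₀¹ U dθ. If |t⁻¹ ∫₀¹ a⁻¹ e^{4U} Q dθ| ≥ 1, then e^{−2⟨U⟩} ≤ Ê₁^{1/2} exp(Ê₁^{1/2}).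 -/
open MeasureTheory

theorem aux_cs (w f g : ℝ → ℝ) (hw : Continuous w) (hf : Continuous f) (hg : Continuous g)
    (hp : ∀ x, 0 < w x) :
    (∫ x in (0 : ℝ)..1, w x * (f x * g x)) ^ 2 ≤
      (∫ x in (0 : ℝ)..1, w x * f x ^ 2) * ∫ x in (0 : ℝ)..1, w x * g x ^ 2 := by
  have key : ∀ r : ℝ, 0 ≤ (∫ x in (0 : ℝ)..1, w x * f x ^ 2) * (r * r) +
      (2 * ∫ x in (0 : ℝ)..1, w x * (f x * g x)) * r + ∫ x in (0 : ℝ)..1, w x * g x ^ 2 := by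
    intro r
    have h0 : 0 ≤ ∫ x in (0 : ℝ)..1, w x * (r * f x + g x) ^ 2 :=
      intervalIntegral.integral_nonneg (by norm_num)
        (fun x _ => mul_nonneg (hp x).le (sq_nonneg _))
    have h1 : (∫ x in (0 : ℝ)..1, w x * (r * f x + g x) ^ 2) =
        ∫ x in (0 : ℝ)..1, ((w x * f x ^ 2) * (r * r) + (w x * (f x * g x)) * (2 * r)
          + w x * g x ^ 2) := by
      congr 1; funext x; ring
    rw [h1, intervalIntegral.integral_add, intervalIntegral.integral_add,
      intervalIntegral.integral_mul_const, intervalIntegral.integral_mul_const] at h0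
    · linarith
    all_goals exact Continuous.intervalIntegrable (by fun_prop) _ _
  have := discrim_le_zero key
  unfold discrim at this
  nlinarith

theorem aux_osc (U : ℝ → ℝ) (hU : ContDiff ℝ 1 U) (θ : ℝ) (hθ : θ ∈ Set.Icc (0 : ℝ) 1) :
    U θ ≤ (∫ s in (0 : ℝ)..1, U s) + ∫ s in (0 : ℝ)..1, |deriv U s| := by
  have hd : Continuous (deriv U) := hU.continuous_deriv le_rfl
  have hc : Continuous U := hU.continuous
  have h1 : ∀ s ∈ Set.Icc (0 : ℝ) 1, U θ - (∫ s in (0 : ℝ)..1, |deriv U s|) ≤ U s := by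
    intro s hs
    have h2 : ∫ x in s..θ, deriv U x = U θ - U s :=
      intervalIntegral.integral_deriv_eq_sub
        (fun x _ => (hU.differentiable (by norm_num)) x) (hd.intervalIntegrable _ _)
    have h3 : |∫ x in s..θ, deriv U x| ≤ ∫ x in (0 : ℝ)..1, |deriv U x| := by
      have h4 := intervalIntegral.norm_integral_le_integral_norm_uIoc
        (f := deriv U) (a := s) (b := θ) (μ := volume)
      refine h4.trans ?_
      rw [intervalIntegral.integral_of_le (zero_le_one' ℝ)]
      refine setIntegral_mono_set ?_ ?_ ?_
      · exact ((continuous_abs.comp hd).intervalIntegrable (μ := volume) 0 1).1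
      · exact Filter.Eventually.of_forall (fun x => abs_nonneg _)
      · refine LE.le.eventuallyLE ?_
        exact Set.Ioc_subset_Ioc (le_min hs.1 hθ.1) (max_le hs.2 hθ.2)
    have := (le_abs_self _).trans h3
    linarith
  have h5 := intervalIntegral.integral_mono_on (zero_le_one' ℝ)
    (intervalIntegrable_const (μ := volume)) (hc.intervalIntegrable (μ := volume) 0 1) h1
  simp only [intervalIntegral.integral_const, sub_zero, one_smul] at h5
  linarith

/-- the estimate used in the case `𝒟 < 0`: if
`|t⁻¹∫₀¹ a⁻¹e^{4U}Q dθ| ≥ 1` (normalization `|ℬ| ≥ 1`), then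
`e^{−2⟨U⟩} ≤ Ê₁^{1/2} exp(Ê₁^{1/2})`. -/
theorem mean_U_estimate_Dneg
    (t : ℝ) (ht : t < 0) (a U A P Q : ℝ → ℝ)
    (ha_cont : Continuous a) (ha_pos : ∀ θ, 0 < a θ) (ha_per : ∀ θ, a (θ + 1) = a θ)
    (hU : ContDiff ℝ 1 U) (hU_per : ∀ θ, U (θ + 1) = U θ)
    (hA : ContDiff ℝ 1 A) (hA_per : ∀ θ, A (θ + 1) = A θ)
    (hP : Continuous P) (hP_per : ∀ θ, P (θ + 1) = P θ)
    (hQ : Continuous Q) (hQ_per : ∀ θ, Q (θ + 1) = Q θ)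
    (hB : 1 ≤ |t⁻¹ * ∫ θ in (0 : ℝ)..1, (a θ)⁻¹ * Real.exp (4 * U θ) * Q θ|) :
    Real.exp (-2 * ∫ θ in (0 : ℝ)..1, U θ) ≤
      Real.sqrt (energyEhat t a U A P Q) *
        Real.exp (Real.sqrt (energyEhat t a U A P Q)) := by
  have hd : Continuous (deriv U) := hU.continuous_deriv le_rfl
  have hdA : Continuous (deriv A) := hA.continuous_deriv le_rfl
  have hc : Continuous U := hU.continuous
  have hne : ∀ x, a x ≠ 0 := fun x => (ha_pos x).ne'
  have hi : Continuous fun x => (a x)⁻¹ := ha_cont.inv₀ hne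
  have hip : ∀ x, 0 < (a x)⁻¹ := fun x => inv_pos.2 (ha_pos x)
  have ht2 : 0 < t ^ 2 := by nlinarith
  set I := ∫ θ in (0 : ℝ)..1, (a θ)⁻¹ with hI
  set E := energyE1 t a U A P Q with hE
  have hI0 : 0 ≤ I := intervalIntegral.integral_nonneg (by norm_num) (fun x _ => (hip x).le)
  have hS : energyEhat t a U A P Q = 4 * E * I := rfl
  have hcE : Continuous fun θ => (a θ)⁻¹ * ((P θ - 1 / (2 * t)) ^ 2 + (a θ) ^ 2 * (deriv U θ) ^ 2 +
      (Real.exp (4 * U θ) / (4 * t ^ 2)) * ((Q θ) ^ 2 + (a θ) ^ 2 * (deriv A θ) ^ 2)) := by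
    fun_prop
  have hE1 : (∫ x in (0 : ℝ)..1, (a x)⁻¹ * (a x * |deriv U x|) ^ 2) ≤ E := by
    refine intervalIntegral.integral_mono_on (by norm_num)
      (Continuous.intervalIntegrable (by fun_prop) _ _) (hcE.intervalIntegrable _ _) ?_
    intro x _
    refine mul_le_mul_of_nonneg_left ?_ (hip x).le
    rw [mul_pow, sq_abs]
    have : 0 ≤ (Real.exp (4 * U x) / (4 * t ^ 2)) * ((Q x) ^ 2 + (a x) ^ 2 * (deriv A x) ^ 2) := by
      positivity
    nlinarith [sq_nonneg (P x - 1 / (2 * t))]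
  have hE2 : (∫ x in (0 : ℝ)..1, (a x)⁻¹ * (Real.exp (2 * U x) * Q x * t⁻¹) ^ 2) ≤ 4 * E := by
    rw [hE, energyE1, ← intervalIntegral.integral_const_mul]
    refine intervalIntegral.integral_mono_on (by norm_num)
      (Continuous.intervalIntegrable (by fun_prop) _ _)
      ((continuous_const.mul hcE).intervalIntegrable _ _) ?_
    intro x _
    rw [mul_left_comm]
    refine mul_le_mul_of_nonneg_left ?_ (hip x).le
    have e4 : Real.exp (4 * U x) = Real.exp (2 * U x) ^ 2 := by
      rw [← Real.exp_nat_mul]; congr 1; push_cast; ring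
    have e5 : (Real.exp (2 * U x) * Q x * t⁻¹) ^ 2
        = 4 * (Real.exp (4 * U x) / (4 * t ^ 2) * Q x ^ 2) := by
      rw [e4]; field_simp
    have : 0 ≤ (Real.exp (4 * U x) / (4 * t ^ 2)) * ((a x) ^ 2 * (deriv A x) ^ 2) := by
      positivity
    have : 0 ≤ (a x) ^ 2 * (deriv U x) ^ 2 := by positivity
    rw [e5, mul_add (Real.exp (4 * U x) / (4 * t ^ 2))]
    nlinarith [sq_nonneg (P x - 1 / (2 * t))]
  have hE0 : 0 ≤ E := le_trans (intervalIntegral.integral_nonneg (by norm_num)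
    (fun x _ => mul_nonneg (hip x).le (sq_nonneg _))) hE1
  set K := ∫ x in (0 : ℝ)..1, |deriv U x| with hK
  have hK1 : K ^ 2 ≤ E * I := by
    have h := aux_cs (fun x => (a x)⁻¹) (fun x => a x * |deriv U x|) (fun _ => 1) hi
      (by fun_prop) (by fun_prop) hip
    have h' : (∫ x in (0 : ℝ)..1, (a x)⁻¹ * (a x * |deriv U x| * 1)) = K := by
      congr 1; funext x; rw [mul_one, inv_mul_cancel_left₀ (hne x)]
    simp only [h', one_pow] at h
    simp only [mul_one] at h
    exact h.trans (mul_le_mul_of_nonneg_right hE1 hI0)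
  rw [hS]
  set S := Real.sqrt (4 * E * I) with hSd
  have hS0 : 0 ≤ S := Real.sqrt_nonneg _
  have hS2 : S ^ 2 = 4 * E * I := Real.sq_sqrt (by positivity)
  have hKS : 2 * K ≤ S := Real.le_sqrt_of_sq_le (by nlinarith)
  set m := ∫ θ in (0 : ℝ)..1, U θ with hm
  have hB2 : 1 ≤ (Real.exp (2 * m + S) * S) ^ 2 := by
    have h := aux_cs (fun x => (a x)⁻¹) (fun x => Real.exp (2 * U x))
      (fun x => Real.exp (2 * U x) * Q x * t⁻¹) hi (by fun_prop) (by fun_prop) hip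
    have h' : (∫ x in (0 : ℝ)..1, (a x)⁻¹ * (Real.exp (2 * U x) *
        (Real.exp (2 * U x) * Q x * t⁻¹))) =
        t⁻¹ * ∫ θ in (0 : ℝ)..1, (a θ)⁻¹ * Real.exp (4 * U θ) * Q θ := by
      rw [← intervalIntegral.integral_const_mul]
      congr 1; funext x
      have e4 : Real.exp (4 * U x) = Real.exp (2 * U x) ^ 2 := by
        rw [← Real.exp_nat_mul]; congr 1; push_cast; ring
      rw [e4]; ring
    have h3 : (∫ x in (0 : ℝ)..1, (a x)⁻¹ * Real.exp (2 * U x) ^ 2) ≤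
        I * Real.exp (2 * m + S) ^ 2 := by
      rw [hI, ← intervalIntegral.integral_mul_const]
      refine intervalIntegral.integral_mono_on (by norm_num)
        (Continuous.intervalIntegrable (by fun_prop) _ _)
        (Continuous.intervalIntegrable (by fun_prop) _ _) ?_
      intro x hx
      refine mul_le_mul_of_nonneg_left ?_ (hip x).le
      have := aux_osc U hU x hx
      gcongr
      linarith
    have h4 : 1 ≤ (t⁻¹ * ∫ θ in (0 : ℝ)..1, (a θ)⁻¹ * Real.exp (4 * U θ) * Q θ) ^ 2 :=
      (one_le_sq_iff_one_le_abs _).2 hB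
    simp only [h'] at h
    have h5 := h.trans (mul_le_mul h3 hE2 (intervalIntegral.integral_nonneg (by norm_num)
      (fun x _ => mul_nonneg (hip x).le (sq_nonneg _))) (by positivity))
    calc (1:ℝ) ≤ _ := h4.trans h5
      _ = _ := by rw [mul_pow, hS2]; ring
  have hB3 : 1 ≤ Real.exp (2 * m + S) * S := by
    have := (one_le_sq_iff_one_le_abs _).1 hB2
    rwa [abs_of_nonneg (by positivity)] at this
  calc Real.exp (-2 * m) = Real.exp (-2 * m) * 1 := (mul_one _).symm
    _ ≤ Real.exp (-2 * m) * (Real.exp (2 * m + S) * S) := by gcongr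
    _ = S * Real.exp S := by
      rw [← mul_assoc, ← Real.exp_add, mul_comm]; congr 2; ring
end

section
/- Let t₀ < t₁ ≤ 0, let U, A : (t₀, t₁) × ℝ → ℝ be twice continuously differentiable and a : (t₀, t₁) × ℝ → ℝ be continuously differentiable and positive, all 1-periodic in the second variable θ. Assume the Gowdy evolution equations hold on (t₀,t₁) × ℝ: ∂ₜ(t⁻¹a⁻¹∂ₜA) − ∂_θ(t⁻¹a∂_θA) = −(4/(at))(∂ₜU ∂ₜA − a² ∂_θU ∂_θA) and ∂ₜ(t a⁻¹(∂ₜU − 1/(2t))) − ∂_θ(t a ∂_θU) = (e^{4U}/(2ta))((∂ₜA)² − a²(∂_θA)²). Then the three functions 𝒜(t) := ∫₀¹ a⁻¹ [t⁻¹e^{4U}(∂ₜA)A − (2t∂ₜU − 1)] dθ, ℬ(t) := ∫₀¹ a⁻¹ t⁻¹ e^{4U} ∂ₜA dθ, and 𝒞(t) := ∫₀¹ a⁻¹ [t⁻¹(∂ₜA)(t² − e^{4U}A²) + 2A(2t∂ₜU − 1)] dθ are constant on (t₀, t₁). -/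
open MeasureTheory

/-- Partial derivative with respect to the first (time) variable. -/
noncomputable def pdt (f : ℝ → ℝ → ℝ) (t θ : ℝ) : ℝ := deriv (fun s => f s θ) t

/-- Partial derivative with respect to the second (space) variable. -/
noncomputable def pdθ (f : ℝ → ℝ → ℝ) (t θ : ℝ) : ℝ := deriv (fun σ => f t σ) θ

lemma strip_open (t₀ t₁ : ℝ) : IsOpen (Set.Ioo t₀ t₁ ×ˢ (Set.univ : Set ℝ)) :=
  isOpen_Ioo.prod isOpen_univ

lemma hasDerivAt_t {t₀ t₁ : ℝ} {F : ℝ → ℝ → ℝ}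
    (hF : ContDiffOn ℝ 1 (Function.uncurry F) (Set.Ioo t₀ t₁ ×ˢ Set.univ))
    {t : ℝ} (ht : t ∈ Set.Ioo t₀ t₁) (θ : ℝ) :
    HasDerivAt (fun s => F s θ) (fderiv ℝ (Function.uncurry F) (t, θ) (1, 0)) t := by
  have h1 : DifferentiableAt ℝ (Function.uncurry F) (t, θ) :=
    (hF.differentiableOn (by norm_num)).differentiableAt
      ((strip_open t₀ t₁).mem_nhds ⟨ht, trivial⟩)
  have h2 : HasDerivAt (fun s : ℝ => (s, θ)) ((1 : ℝ), (0 : ℝ)) t :=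
    (hasDerivAt_id t).prodMk (hasDerivAt_const t θ)
  exact h1.hasFDerivAt.comp_hasDerivAt t h2

lemma hasDerivAt_θ {t₀ t₁ : ℝ} {F : ℝ → ℝ → ℝ}
    (hF : ContDiffOn ℝ 1 (Function.uncurry F) (Set.Ioo t₀ t₁ ×ˢ Set.univ))
    {t : ℝ} (ht : t ∈ Set.Ioo t₀ t₁) (θ : ℝ) :
    HasDerivAt (fun s => F t s) (fderiv ℝ (Function.uncurry F) (t, θ) (0, 1)) θ := by
  have h1 : DifferentiableAt ℝ (Function.uncurry F) (t, θ) :=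
    (hF.differentiableOn (by norm_num)).differentiableAt
      ((strip_open t₀ t₁).mem_nhds ⟨ht, trivial⟩)
  have h2 : HasDerivAt (fun s : ℝ => (t, s)) ((0 : ℝ), (1 : ℝ)) θ :=
    (hasDerivAt_const θ t).prodMk (hasDerivAt_id θ)
  exact h1.hasFDerivAt.comp_hasDerivAt θ h2

lemma hasDerivAt_pdt {t₀ t₁ : ℝ} {F : ℝ → ℝ → ℝ}
    (hF : ContDiffOn ℝ 1 (Function.uncurry F) (Set.Ioo t₀ t₁ ×ˢ Set.univ))
    {t : ℝ} (ht : t ∈ Set.Ioo t₀ t₁) (θ : ℝ) :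
    HasDerivAt (fun s => F s θ) (pdt F t θ) t :=
  (hasDerivAt_t hF ht θ).differentiableAt.hasDerivAt

lemma hasDerivAt_pdθ {t₀ t₁ : ℝ} {F : ℝ → ℝ → ℝ}
    (hF : ContDiffOn ℝ 1 (Function.uncurry F) (Set.Ioo t₀ t₁ ×ˢ Set.univ))
    {t : ℝ} (ht : t ∈ Set.Ioo t₀ t₁) (θ : ℝ) :
    HasDerivAt (fun s => F t s) (pdθ F t θ) θ :=
  (hasDerivAt_θ hF ht θ).differentiableAt.hasDerivAt

lemma contDiffOn_pd {t₀ t₁ : ℝ} {F : ℝ → ℝ → ℝ} {m n : WithTop ℕ∞} (hmn : m + 1 ≤ n)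
    (hn : 1 ≤ n)
    (hF : ContDiffOn ℝ n (Function.uncurry F) (Set.Ioo t₀ t₁ ×ˢ Set.univ)) :
    ContDiffOn ℝ m (Function.uncurry (pdt F)) (Set.Ioo t₀ t₁ ×ˢ Set.univ) ∧
    ContDiffOn ℝ m (Function.uncurry (pdθ F)) (Set.Ioo t₀ t₁ ×ˢ Set.univ) := by
  have h := hF.fderiv_of_isOpen (strip_open t₀ t₁) hmn
  constructor
  · refine (h.clm_apply (contDiffOn_const (c := ((1 : ℝ), (0 : ℝ))))).congr ?_
    rintro ⟨t, θ⟩ ⟨ht, -⟩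
    exact (hasDerivAt_t (hF.of_le hn) ht θ).deriv
  · refine (h.clm_apply (contDiffOn_const (c := ((0 : ℝ), (1 : ℝ))))).congr ?_
    rintro ⟨t, θ⟩ ⟨ht, -⟩
    exact (hasDerivAt_θ (hF.of_le hn) ht θ).deriv

lemma integral_const_of_conservation {t₀ t₁ : ℝ} {F G : ℝ → ℝ → ℝ}
    (hF : ContDiffOn ℝ 1 (Function.uncurry F) (Set.Ioo t₀ t₁ ×ˢ Set.univ))
    (hG : ContDiffOn ℝ 1 (Function.uncurry G) (Set.Ioo t₀ t₁ ×ˢ Set.univ))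
    (hFG : ∀ t ∈ Set.Ioo t₀ t₁, ∀ θ, pdt F t θ = pdθ G t θ)
    (hper : ∀ t ∈ Set.Ioo t₀ t₁, G t 1 = G t 0) :
    ∀ s₁ ∈ Set.Ioo t₀ t₁, ∀ s₂ ∈ Set.Ioo t₀ t₁,
      (∫ θ in (0 : ℝ)..1, F s₁ θ) = ∫ θ in (0 : ℝ)..1, F s₂ θ := by
  have hF' : ContinuousOn (Function.uncurry (pdt F)) (Set.Ioo t₀ t₁ ×ˢ Set.univ) :=
    (contDiffOn_pd (m := 0) (by norm_num) le_rfl hF).1.continuousOn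
  have slice : ∀ {H : ℝ → ℝ → ℝ}, ContinuousOn (Function.uncurry H) (Set.Ioo t₀ t₁ ×ˢ Set.univ) →
      ∀ t ∈ Set.Ioo t₀ t₁, Continuous (H t) := by
    intro H hH t ht
    have := hH.comp_continuous (f := fun θ : ℝ => (t, θ)) (by fun_prop) (fun θ => ⟨ht, trivial⟩)
    exact this
  have key : ∀ t ∈ Set.Ioo t₀ t₁, HasDerivAt (fun t => ∫ θ in (0 : ℝ)..1, F t θ) 0 t := by
    intro t ht
    obtain ⟨ε, hε, hball⟩ := Metric.nhds_basis_closedBall.mem_iff.1 (isOpen_Ioo.mem_nhds ht)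
    have hK : IsCompact (Metric.closedBall t ε ×ˢ Set.Icc (0 : ℝ) 1) :=
      (isCompact_closedBall t ε).prod isCompact_Icc
    obtain ⟨C, hC⟩ := hK.exists_bound_of_continuousOn
      (hF'.mono (Set.prod_mono hball (Set.subset_univ _)))
    have hd := (intervalIntegral.hasDerivAt_integral_of_dominated_loc_of_deriv_le
      (μ := volume) (a := 0) (b := 1) (F := F) (F' := pdt F) (x₀ := t) (bound := fun _ => C)
      (Metric.closedBall_mem_nhds t hε)
      (by
        filter_upwards [isOpen_Ioo.mem_nhds ht] with s hs
        exact (slice hF.continuousOn s hs).aestronglyMeasurable)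
      ((slice hF.continuousOn t ht).intervalIntegrable _ _)
      ((slice hF' t ht).aestronglyMeasurable)
      (by
        refine Filter.Eventually.of_forall fun θ hθ s hs => ?_
        rw [Set.uIoc_of_le zero_le_one] at hθ
        exact hC (s, θ) ⟨hs, ⟨hθ.1.le, hθ.2⟩⟩)
      (by simp)
      (by
        refine Filter.Eventually.of_forall fun θ hθ s hs => ?_
        exact hasDerivAt_pdt hF (hball hs) θ)).2
    have h0 : (∫ θ in (0 : ℝ)..1, pdt F t θ) = 0 := by
      rw [intervalIntegral.integral_eq_sub_of_hasDerivAt (f := G t) (f' := pdt F t)]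
      · rw [hper t ht, sub_self]
      · intro θ _
        rw [hFG t ht θ]
        exact hasDerivAt_pdθ hG ht θ
      · exact (slice hF' t ht).intervalIntegrable _ _
    rwa [h0] at hd
  intro s₁ h₁ s₂ h₂
  have hd : DifferentiableOn ℝ (fun t => ∫ θ in (0 : ℝ)..1, F t θ) (Set.Ioo t₀ t₁) :=
    fun t ht => (key t ht).differentiableAt.differentiableWithinAt
  exact isOpen_Ioo.is_const_of_deriv_eq_zero (convex_Ioo t₀ t₁).isPreconnected hd
    (fun t ht => (key t ht).deriv) h₁ h₂

/-- for solutions of the Gowdy evolution equations on `(t₀, t₁) × S¹`,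
the three functionals `𝒜(t)`, `ℬ(t)`, `𝒞(t)` are constant in time (Lemma 2.3). -/
theorem conserved_quantities_constant
    (t₀ t₁ : ℝ) (ht : t₀ < t₁) (ht₁ : t₁ ≤ 0)
    (U A a : ℝ → ℝ → ℝ)
    (hU : ContDiffOn ℝ 2 (Function.uncurry U) (Set.Ioo t₀ t₁ ×ˢ Set.univ))
    (hA : ContDiffOn ℝ 2 (Function.uncurry A) (Set.Ioo t₀ t₁ ×ˢ Set.univ))
    (ha : ContDiffOn ℝ 1 (Function.uncurry a) (Set.Ioo t₀ t₁ ×ˢ Set.univ))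
    (ha_pos : ∀ t ∈ Set.Ioo t₀ t₁, ∀ θ : ℝ, 0 < a t θ)
    (hU_per : ∀ t ∈ Set.Ioo t₀ t₁, ∀ θ : ℝ, U t (θ + 1) = U t θ)
    (hA_per : ∀ t ∈ Set.Ioo t₀ t₁, ∀ θ : ℝ, A t (θ + 1) = A t θ)
    (ha_per : ∀ t ∈ Set.Ioo t₀ t₁, ∀ θ : ℝ, a t (θ + 1) = a t θ)
    (heqA : ∀ t ∈ Set.Ioo t₀ t₁, ∀ θ : ℝ,
      pdt (fun s σ => s⁻¹ * (a s σ)⁻¹ * pdt A s σ) t θ -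
        pdθ (fun s σ => s⁻¹ * a s σ * pdθ A s σ) t θ =
      -(4 / (a t θ * t)) *
        (pdt U t θ * pdt A t θ - (a t θ) ^ 2 * pdθ U t θ * pdθ A t θ))
    (heqU : ∀ t ∈ Set.Ioo t₀ t₁, ∀ θ : ℝ,
      pdt (fun s σ => s * (a s σ)⁻¹ * (pdt U s σ - 1 / (2 * s))) t θ -
        pdθ (fun s σ => s * a s σ * pdθ U s σ) t θ =
      (Real.exp (4 * U t θ) / (2 * t * a t θ)) *
        ((pdt A t θ) ^ 2 - (a t θ) ^ 2 * (pdθ A t θ) ^ 2)) :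
    (∀ s₁ ∈ Set.Ioo t₀ t₁, ∀ s₂ ∈ Set.Ioo t₀ t₁,
      (∫ θ in (0 : ℝ)..1, (a s₁ θ)⁻¹ *
        (s₁⁻¹ * Real.exp (4 * U s₁ θ) * pdt A s₁ θ * A s₁ θ - (2 * s₁ * pdt U s₁ θ - 1))) =
      (∫ θ in (0 : ℝ)..1, (a s₂ θ)⁻¹ *
        (s₂⁻¹ * Real.exp (4 * U s₂ θ) * pdt A s₂ θ * A s₂ θ - (2 * s₂ * pdt U s₂ θ - 1)))) ∧
    (∀ s₁ ∈ Set.Ioo t₀ t₁, ∀ s₂ ∈ Set.Ioo t₀ t₁,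
      (∫ θ in (0 : ℝ)..1, (a s₁ θ)⁻¹ * s₁⁻¹ * Real.exp (4 * U s₁ θ) * pdt A s₁ θ) =
      (∫ θ in (0 : ℝ)..1, (a s₂ θ)⁻¹ * s₂⁻¹ * Real.exp (4 * U s₂ θ) * pdt A s₂ θ)) ∧
    (∀ s₁ ∈ Set.Ioo t₀ t₁, ∀ s₂ ∈ Set.Ioo t₀ t₁,
      (∫ θ in (0 : ℝ)..1, (a s₁ θ)⁻¹ *
        (s₁⁻¹ * pdt A s₁ θ * (s₁ ^ 2 - Real.exp (4 * U s₁ θ) * (A s₁ θ) ^ 2) +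
          2 * A s₁ θ * (2 * s₁ * pdt U s₁ θ - 1))) =
      (∫ θ in (0 : ℝ)..1, (a s₂ θ)⁻¹ *
        (s₂⁻¹ * pdt A s₂ θ * (s₂ ^ 2 - Real.exp (4 * U s₂ θ) * (A s₂ θ) ^ 2) +
          2 * A s₂ θ * (2 * s₂ * pdt U s₂ θ - 1)))) := by
  have hS0 : ∀ t ∈ Set.Ioo t₀ t₁, t ≠ 0 := fun t h => (lt_of_lt_of_le h.2 ht₁).ne
  have hpd : (2 : WithTop ℕ∞) = 1 + 1 := by norm_num
  obtain ⟨hUt, hUθ⟩ := contDiffOn_pd (m := 1) hpd.ge (by norm_num) hU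
  obtain ⟨hAt, hAθ⟩ := contDiffOn_pd (m := 1) hpd.ge (by norm_num) hA
  replace hU := hU.of_le (m := 1) (by norm_num)
  replace hA := hA.of_le (m := 1) (by norm_num)
  have hT : ContDiffOn ℝ 1 (Function.uncurry (fun s _ : ℝ => s)) (Set.Ioo t₀ t₁ ×ˢ Set.univ) :=
    contDiff_fst.contDiffOn
  have hTi : ContDiffOn ℝ 1 (Function.uncurry (fun s _ : ℝ => s⁻¹)) (Set.Ioo t₀ t₁ ×ˢ Set.univ) :=
    hT.inv (fun x hx => hS0 _ hx.1)
  have hai : ContDiffOn ℝ 1 (Function.uncurry (fun s σ : ℝ => (a s σ)⁻¹))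
      (Set.Ioo t₀ t₁ ×ˢ Set.univ) := ha.inv (fun x hx => (ha_pos _ hx.1 _).ne')
  have hE : ContDiffOn ℝ 1 (Function.uncurry (fun s σ : ℝ => Real.exp (4 * U s σ)))
      (Set.Ioo t₀ t₁ ×ˢ Set.univ) := (contDiffOn_const.mul hU).exp
  obtain ⟨P, hPdef⟩ : ∃ P : ℝ → ℝ → ℝ, P = fun s σ => s⁻¹ * (a s σ)⁻¹ * pdt A s σ := ⟨_, rfl⟩
  obtain ⟨Q, hQdef⟩ : ∃ P : ℝ → ℝ → ℝ, P = fun s σ => s⁻¹ * a s σ * pdθ A s σ := ⟨_, rfl⟩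
  obtain ⟨R, hRdef⟩ : ∃ P : ℝ → ℝ → ℝ,
    P = fun s σ => s * (a s σ)⁻¹ * (pdt U s σ - 1 / (2 * s)) := ⟨_, rfl⟩
  obtain ⟨S, hSdef⟩ : ∃ P : ℝ → ℝ → ℝ, P = fun s σ => s * a s σ * pdθ U s σ := ⟨_, rfl⟩
  have hP : ContDiffOn ℝ 1 (Function.uncurry P) (Set.Ioo t₀ t₁ ×ˢ Set.univ) := by
    rw [hPdef]; exact (hTi.mul hai).mul hAt
  have hQ : ContDiffOn ℝ 1 (Function.uncurry Q) (Set.Ioo t₀ t₁ ×ˢ Set.univ) := by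
    rw [hQdef]; exact (hTi.mul ha).mul hAθ
  have hR : ContDiffOn ℝ 1 (Function.uncurry R) (Set.Ioo t₀ t₁ ×ˢ Set.univ) := by
    rw [hRdef]
    refine (hT.mul hai).mul (hUt.sub (contDiffOn_const.div (contDiffOn_const.mul hT) ?_))
    exact fun x hx => mul_ne_zero two_ne_zero (hS0 _ hx.1)
  have hS : ContDiffOn ℝ 1 (Function.uncurry S) (Set.Ioo t₀ t₁ ×ˢ Set.univ) := by
    rw [hSdef]; exact (hT.mul ha).mul hUθ
  rw [← hPdef, ← hQdef] at heqA
  rw [← hRdef, ← hSdef] at heqU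
  -- periodicity
  have per : ∀ {H : ℝ → ℝ → ℝ}, (∀ t ∈ Set.Ioo t₀ t₁, ∀ θ : ℝ, H t (θ + 1) = H t θ) →
      ∀ t ∈ Set.Ioo t₀ t₁, H t 1 = H t 0 ∧ pdθ H t 1 = pdθ H t 0 := by
    intro H hH t ht
    refine ⟨by simpa using hH t ht 0, ?_⟩
    have h := deriv_comp_add_const (fun σ => H t σ) 1 0
    simp only [hH t ht, zero_add] at h
    exact h.symm
  have hQper : ∀ t ∈ Set.Ioo t₀ t₁, Q t 1 = Q t 0 := by
    intro t ht
    simp only [hQdef, (per hA_per t ht).2, (per ha_per t ht).1]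
  have hSper : ∀ t ∈ Set.Ioo t₀ t₁, S t 1 = S t 0 := by
    intro t ht
    simp only [hSdef, (per hU_per t ht).2, (per ha_per t ht).1]
  -- algebraic relations
  have e1 : ∀ t ∈ Set.Ioo t₀ t₁, ∀ θ : ℝ, pdt P t θ =
      pdθ Q t θ - 4 * (pdt U t θ * P t θ - pdθ U t θ * Q t θ) := by
    intro t ht θ
    have h0 := hS0 t ht
    have h1 := (ha_pos t ht θ).ne'
    have h2 : -(4 / (a t θ * t)) *
        (pdt U t θ * pdt A t θ - (a t θ) ^ 2 * pdθ U t θ * pdθ A t θ) =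
        - 4 * (pdt U t θ * P t θ - pdθ U t θ * Q t θ) := by
      simp only [hPdef, hQdef]
      field_simp
    linarith [heqA t ht θ]
  have e2 : ∀ t ∈ Set.Ioo t₀ t₁, ∀ θ : ℝ, pdt R t θ =
      pdθ S t θ + Real.exp (4 * U t θ) / 2 * (pdt A t θ * P t θ - pdθ A t θ * Q t θ) := by
    intro t ht θ
    have h0 := hS0 t ht
    have h1 := (ha_pos t ht θ).ne'
    have h2 : (Real.exp (4 * U t θ) / (2 * t * a t θ)) *
        ((pdt A t θ) ^ 2 - (a t θ) ^ 2 * (pdθ A t θ) ^ 2) =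
        Real.exp (4 * U t θ) / 2 * (pdt A t θ * P t θ - pdθ A t θ * Q t θ) := by
      simp only [hPdef, hQdef]
      field_simp
    linarith [heqU t ht θ]
  have e3 : ∀ t ∈ Set.Ioo t₀ t₁, ∀ θ : ℝ,
      pdt A t θ * R t θ = t ^ 2 * P t θ * pdt U t θ - t * P t θ / 2 := by
    intro t ht θ
    have h0 := hS0 t ht
    have h1 := (ha_pos t ht θ).ne'
    simp only [hPdef, hRdef]
    field_simp
  have e4 : ∀ t ∈ Set.Ioo t₀ t₁, ∀ θ : ℝ,
      pdθ A t θ * S t θ = t ^ 2 * pdθ U t θ * Q t θ := by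
    intro t ht θ
    have h0 := hS0 t ht
    have h1 := (ha_pos t ht θ).ne'
    simp only [hSdef, hQdef]
    field_simp
  have conv : ∀ {f g : ℝ → ℝ → ℝ}, (∀ t ∈ Set.Ioo t₀ t₁, ∀ θ : ℝ, f t θ = g t θ) →
      (∀ s₁ ∈ Set.Ioo t₀ t₁, ∀ s₂ ∈ Set.Ioo t₀ t₁,
        (∫ θ in (0 : ℝ)..1, g s₁ θ) = ∫ θ in (0 : ℝ)..1, g s₂ θ) →
      (∀ s₁ ∈ Set.Ioo t₀ t₁, ∀ s₂ ∈ Set.Ioo t₀ t₁,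
        (∫ θ in (0 : ℝ)..1, f s₁ θ) = ∫ θ in (0 : ℝ)..1, f s₂ θ) := by
    intro f g hfg h s₁ h₁ s₂ h₂
    rw [show f s₁ = g s₁ from funext (hfg s₁ h₁), show f s₂ = g s₂ from funext (hfg s₂ h₂)]
    exact h s₁ h₁ s₂ h₂
  refine ⟨?_, ?_, ?_⟩
  · refine conv (f := fun s θ => (a s θ)⁻¹ *
        (s⁻¹ * Real.exp (4 * U s θ) * pdt A s θ * A s θ - (2 * s * pdt U s θ - 1)))
      (g := fun s θ => Real.exp (4 * U s θ) * P s θ * A s θ - 2 * R s θ) ?_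
      (integral_const_of_conservation
        (G := fun s θ => Real.exp (4 * U s θ) * Q s θ * A s θ - 2 * S s θ)
        (((hE.mul hP).mul hA).sub (contDiffOn_const.mul hR))
        (((hE.mul hQ).mul hA).sub (contDiffOn_const.mul hS)) ?_ ?_)
    · intro t ht θ
      have h0 := hS0 t ht
      have h1 := (ha_pos t ht θ).ne'
      simp only [hPdef, hRdef]
      field_simp
    · intro t ht θ
      have d1 := (((((hasDerivAt_pdt hU ht θ).const_mul 4).exp).mul (hasDerivAt_pdt hP ht θ)).mul
        (hasDerivAt_pdt hA ht θ)).sub ((hasDerivAt_pdt hR ht θ).const_mul 2)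
      have d2 := (((((hasDerivAt_pdθ hU ht θ).const_mul 4).exp).mul (hasDerivAt_pdθ hQ ht θ)).mul
        (hasDerivAt_pdθ hA ht θ)).sub ((hasDerivAt_pdθ hS ht θ).const_mul 2)
      refine d1.deriv.trans (Eq.trans ?_ d2.deriv.symm)
      simp only [Pi.mul_apply, e1 t ht θ, e2 t ht θ]
      ring
    · intro t ht
      simp only [hQper t ht, hSper t ht, (per hU_per t ht).1, (per hA_per t ht).1]
  · refine conv (f := fun s θ => (a s θ)⁻¹ * s⁻¹ * Real.exp (4 * U s θ) * pdt A s θ)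
      (g := fun s θ => Real.exp (4 * U s θ) * P s θ) ?_
      (integral_const_of_conservation
        (G := fun s θ => Real.exp (4 * U s θ) * Q s θ)
        (hE.mul hP) (hE.mul hQ) ?_ ?_)
    · intro t ht θ
      simp only [hPdef]
      ring
    · intro t ht θ
      have d1 := (((hasDerivAt_pdt hU ht θ).const_mul 4).exp).mul (hasDerivAt_pdt hP ht θ)
      have d2 := (((hasDerivAt_pdθ hU ht θ).const_mul 4).exp).mul (hasDerivAt_pdθ hQ ht θ)
      refine d1.deriv.trans (Eq.trans ?_ d2.deriv.symm)
      simp only [e1 t ht θ]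
      ring
    · intro t ht
      simp only [hQper t ht, (per hU_per t ht).1]
  · refine conv (f := fun s θ => (a s θ)⁻¹ *
        (s⁻¹ * pdt A s θ * (s ^ 2 - Real.exp (4 * U s θ) * (A s θ) ^ 2) +
          2 * A s θ * (2 * s * pdt U s θ - 1)))
      (g := fun s θ => s ^ 2 * P s θ - Real.exp (4 * U s θ) * P s θ * A s θ ^ 2
        + 4 * (A s θ * R s θ)) ?_
      (integral_const_of_conservation
        (G := fun s θ => s ^ 2 * Q s θ - Real.exp (4 * U s θ) * Q s θ * A s θ ^ 2
          + 4 * (A s θ * S s θ))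
        ((((hT.pow 2).mul hP).sub ((hE.mul hP).mul (hA.pow 2))).add
          (contDiffOn_const.mul (hA.mul hR)))
        ((((hT.pow 2).mul hQ).sub ((hE.mul hQ).mul (hA.pow 2))).add
          (contDiffOn_const.mul (hA.mul hS))) ?_ ?_)
    · intro t ht θ
      have h0 := hS0 t ht
      have h1 := (ha_pos t ht θ).ne'
      simp only [hPdef, hRdef]
      field_simp
      ring
    · intro t ht θ
      have d1 := ((((hasDerivAt_id t).pow 2).mul (hasDerivAt_pdt hP ht θ)).sub
        (((((hasDerivAt_pdt hU ht θ).const_mul 4).exp).mul (hasDerivAt_pdt hP ht θ)).mul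
        ((hasDerivAt_pdt hA ht θ).pow 2))).add
        (((hasDerivAt_pdt hA ht θ).mul (hasDerivAt_pdt hR ht θ)).const_mul 4)
      have d2 := (((hasDerivAt_pdθ hQ ht θ).const_mul (t ^ 2)).sub
        (((((hasDerivAt_pdθ hU ht θ).const_mul 4).exp).mul (hasDerivAt_pdθ hQ ht θ)).mul
        ((hasDerivAt_pdθ hA ht θ).pow 2))).add
        (((hasDerivAt_pdθ hA ht θ).mul (hasDerivAt_pdθ hS ht θ)).const_mul 4)
      refine d1.deriv.trans (Eq.trans ?_ d2.deriv.symm)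
      simp only [Pi.mul_apply, Pi.pow_apply, id, e1 t ht θ, e2 t ht θ, e3 t ht θ, e4 t ht θ]
      push_cast
      ring
    · intro t ht
      simp only [hQper t ht, hSper t ht, (per hU_per t ht).1, (per hA_per t ht).1]
end

section
/- Let I ⊆ (−∞, 0) be an interval and let a, U, A : I → ℝ with a > 0, U and A twice differentiable and a differentiable, satisfying the spatially homogeneous equations d/dt [a⁻¹ t (U′(t) − 1/(2t))] = e^{4U}(A′)²/(2at) and d/dt [a⁻¹ t⁻¹ e^{2U} A′] = −(2e^{2U}/(at)) U′ A′ on I. Then the function t ↦ a(t)⁻² [(2tU′(t) − 1)² + e^{4U(t)} (A′(t))²] is constant on I. -/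
/-- for the spatially homogeneous equations (2.12), the quantity
`a⁻²[(2tU′ − 1)² + e^{4U}A′²]` (which equals `4a⁻¹t²E₁(t) = 𝒟`) is constant. -/
theorem homogeneous_invariant_constant
    (I : Set ℝ) (hI : I ⊆ Set.Iio (0 : ℝ)) (hI' : I.OrdConnected)
    (a U A : ℝ → ℝ)
    (ha_pos : ∀ t ∈ I, 0 < a t)
    (ha_diff : ∀ t ∈ I, DifferentiableAt ℝ a t)
    (hU_diff : ∀ t ∈ I, DifferentiableAt ℝ U t)
    (hU_diff2 : ∀ t ∈ I, DifferentiableAt ℝ (deriv U) t)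
    (hA_diff : ∀ t ∈ I, DifferentiableAt ℝ A t)
    (hA_diff2 : ∀ t ∈ I, DifferentiableAt ℝ (deriv A) t)
    (heqU : ∀ t ∈ I,
      deriv (fun s => (a s)⁻¹ * s * (deriv U s - 1 / (2 * s))) t =
        Real.exp (4 * U t) * (deriv A t) ^ 2 / (2 * a t * t))
    (heqA : ∀ t ∈ I,
      deriv (fun s => (a s)⁻¹ * s⁻¹ * Real.exp (2 * U s) * deriv A s) t =
        -(2 * Real.exp (2 * U t) / (a t * t)) * deriv U t * deriv A t) :
    ∀ s₁ ∈ I, ∀ s₂ ∈ I,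
      (a s₁)⁻¹ ^ 2 * ((2 * s₁ * deriv U s₁ - 1) ^ 2 + Real.exp (4 * U s₁) * (deriv A s₁) ^ 2) =
      (a s₂)⁻¹ ^ 2 * ((2 * s₂ * deriv U s₂ - 1) ^ 2 + Real.exp (4 * U s₂) * (deriv A s₂) ^ 2) := by
  have hne : ∀ t ∈ I, t ≠ 0 := fun t ht => ne_of_lt (hI ht)
  set F : ℝ → ℝ := fun s => (a s)⁻¹ * s * (deriv U s - 1 / (2 * s)) with hF
  set G : ℝ → ℝ := fun s => (a s)⁻¹ * s⁻¹ * Real.exp (2 * U s) * deriv A s with hG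
  have hexp : ∀ t, Real.exp (4 * U t) = Real.exp (2 * U t) ^ 2 := by
    intro t
    rw [← Real.exp_nat_mul]
    congr 1
    push_cast
    ring
  have key : ∀ t ∈ I, (a t)⁻¹ ^ 2 * ((2 * t * deriv U t - 1) ^ 2
      + Real.exp (4 * U t) * (deriv A t) ^ 2) = 4 * (F t) ^ 2 + (t * G t) ^ 2 := by
    intro t ht
    have h0 := hne t ht
    have h1 := (ha_pos t ht).ne'
    simp only [hF, hG, hexp]
    field_simp
    try ring
  have hder : ∀ t ∈ I, HasDerivWithinAt (fun s => 4 * (F s) ^ 2 + (s * G s) ^ 2) 0 I t := by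
    intro t ht
    have h0 := hne t ht
    have h1 := (ha_pos t ht).ne'
    have d1 := ha_diff t ht
    have d2 := hU_diff t ht
    have d3 := hU_diff2 t ht
    have d4 := hA_diff2 t ht
    have h2 : (2 * t) ≠ 0 := mul_ne_zero two_ne_zero h0
    have i1 : DifferentiableAt ℝ (fun s => (a s)⁻¹) t := d1.fun_inv h1
    have i2 : DifferentiableAt ℝ (fun s : ℝ => s⁻¹) t := differentiableAt_id.fun_inv h0
    have i3 : DifferentiableAt ℝ (fun s : ℝ => 1 / (2 * s)) t :=
      (differentiableAt_const _).fun_div (differentiableAt_id.const_mul 2) h2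
    have dF : DifferentiableAt ℝ F t := (i1.fun_mul differentiableAt_id).fun_mul (d3.fun_sub i3)
    have dG : DifferentiableAt ℝ G t := ((i1.fun_mul i2).fun_mul (d2.const_mul 2).exp).fun_mul d4
    have eF := dF.hasDerivAt
    have eG := dG.hasDerivAt
    rw [heqU t ht] at eF
    rw [heqA t ht] at eG
    have := (((eF.fun_pow 2).const_mul 4).fun_add
      (((hasDerivAt_id' t).fun_mul eG).fun_pow 2)).hasDerivWithinAt (s := I)
    refine this.congr_deriv ?_
    simp only [hF, hG, hexp]
    field_simp
    try ring
  intro s₁ h₁ s₂ h₂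
  rw [key s₁ h₁, key s₂ h₂]
  have := Convex.norm_image_sub_le_of_norm_hasDerivWithin_le (C := 0) hder
    (fun x _ => by simp) hI'.convex h₂ h₁
  rw [zero_mul] at this
  exact sub_eq_zero.mp (norm_le_zero_iff.mp this)
end
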